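/- arXiv:2403.04101 — 4 statements merged into one kernel-verified Lean document; each statement's English description precedes it below -/
import Mathlib

section
/- Let k ≥ 3, let λ = (k, k, 1), and set λ_{(2)} = (k, k−1, 1), λ_{(3)} = (k, k), λ_{(2,3)} = (k, k−1), λ_{(2,↑)} = (k−1, k−1, 1), λ_{(2,←)} = (k, k−2, 1). Let β_1 = (2k, k, k) and β_2 = (k, k, k, k). Then for each i ∈ {1, 2}, the Littlewood–Richardson coefficients are: c^{β_i}_{λ_{(2)}, λ_{(3)}} = 0, c^{β_i}_{λ_{(2)}, λ_{(2)}} = 1, c^{β_i}_{λ_{(3)}, λ_{(3)}} = 1, c^{β_i}_{λ, λ_{(2,3)}} = 1, c^{β_i}_{λ, λ_{(2,↑)}} = 0, and c^{β_i}_{λ, λ_{(2,←)}} = 0. -/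
noncomputable section

/-- The number of (nonzero) parts of a partition `lam : ℕ → ℕ` (parts indexed from `0`). -/
def partLen (lam : ℕ → ℕ) : ℕ := sInf {N | lam N = 0}

/-- A partition, as a weakly decreasing, eventually zero function `ℕ → ℕ`. -/
def IsPartition (lam : ℕ → ℕ) : Prop := Antitone lam ∧ ∃ N, ∀ i, N ≤ i → lam i = 0

/-- `(i, j)` is a cell of the skew shape `lam / mu` (rows and columns indexed from `0`). -/
def IsCell (lam mu : ℕ → ℕ) (i j : ℕ) : Prop := mu i ≤ j ∧ j < lam i

/-- A Littlewood–Richardson tableau of skew shape `lam / mu` with content `nu`: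
a filling of the cells of `lam / mu` with positive integers (`0` outside the shape),
weakly increasing along rows, strictly increasing down columns, with exactly `nu (m - 1)`
entries equal to `m` for each `m ≥ 1`, whose reverse reading word (right to left, top
row to bottom row) is a lattice permutation. -/
structure LRTableau (lam mu nu : ℕ → ℕ) where
  entry : ℕ → ℕ → ℕ
  pos : ∀ i j, IsCell lam mu i j → 1 ≤ entry i j
  zero : ∀ i j, ¬ IsCell lam mu i j → entry i j = 0
  row_weak : ∀ i j j', j ≤ j' → IsCell lam mu i j → IsCell lam mu i j' →
    entry i j ≤ entry i j'
  col_strict : ∀ i i' j, i < i' → IsCell lam mu i j → IsCell lam mu i' j →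
    entry i j < entry i' j
  content : ∀ m, 1 ≤ m →
    Nat.card {p : ℕ × ℕ // IsCell lam mu p.1 p.2 ∧ entry p.1 p.2 = m} = nu (m - 1)
  lattice : ∀ i j m, 1 ≤ m →
    Nat.card {p : ℕ × ℕ // IsCell lam mu p.1 p.2 ∧ entry p.1 p.2 = m + 1 ∧
        (p.1 < i ∨ (p.1 = i ∧ j ≤ p.2))} ≤
      Nat.card {p : ℕ × ℕ // IsCell lam mu p.1 p.2 ∧ entry p.1 p.2 = m ∧
        (p.1 < i ∨ (p.1 = i ∧ j ≤ p.2))}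

/-- The Littlewood–Richardson coefficient `c^{lam}_{mu, nu}`: the number of
Littlewood–Richardson tableaux of shape `lam / mu` with content `nu`. -/
def lrCoeff (lam mu nu : ℕ → ℕ) : ℕ := Nat.card (LRTableau lam mu nu)


/-- The partition `λ = (k, k, 1)`. -/
def kkone (k : ℕ) : ℕ → ℕ := fun i => if i < 2 then k else if i = 2 then 1 else 0

/-- `λ_(2) = (k, k - 1, 1)` for `λ = (k, k, 1)`. -/
def kkone2 (k : ℕ) : ℕ → ℕ :=
  fun i => if i = 0 then k else if i = 1 then k - 1 else if i = 2 then 1 else 0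

/-- `λ_(3) = (k, k)` for `λ = (k, k, 1)`. -/
def kkone3 (k : ℕ) : ℕ → ℕ := fun i => if i < 2 then k else 0

/-- `λ_(2,3) = (k, k - 1)` for `λ = (k, k, 1)`. -/
def kkone23 (k : ℕ) : ℕ → ℕ := fun i => if i = 0 then k else if i = 1 then k - 1 else 0

/-- `λ_(2,↑) = (k - 1, k - 1, 1)` for `λ = (k, k, 1)`. -/
def kkoneUp (k : ℕ) : ℕ → ℕ := fun i => if i < 2 then k - 1 else if i = 2 then 1 else 0

/-- `λ_(2,←) = (k, k - 2, 1)` for `λ = (k, k, 1)`. -/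
def kkoneLeft (k : ℕ) : ℕ → ℕ :=
  fun i => if i = 0 then k else if i = 1 then k - 2 else if i = 2 then 1 else 0

namespace LRTableau

variable {lam mu nu : ℕ → ℕ}

theorem ext_of_cells {T S : LRTableau lam mu nu}
    (h : ∀ i j, IsCell lam mu i j → T.entry i j = S.entry i j) : T = S := by
  have he : T.entry = S.entry := by
    funext i j
    by_cases hc : IsCell lam mu i j
    · exact h i j hc
    · rw [T.zero i j hc, S.zero i j hc]
  cases T
  cases S
  cases he
  rfl

/-- In a Littlewood–Richardson tableau, each entry `m + 1 ≥ 2` has an entry `m` in a strictly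
higher row. -/
theorem exists_above (T : LRTableau lam mu nu)
    (hfin : {p : ℕ × ℕ | IsCell lam mu p.1 p.2}.Finite) {i j m : ℕ} (hm : 1 ≤ m)
    (hc : IsCell lam mu i j) (he : T.entry i j = m + 1) :
    ∃ i' j', i' < i ∧ IsCell lam mu i' j' ∧ T.entry i' j' = m := by
  have hl := T.lattice i j m hm
  have : Finite {p : ℕ × ℕ // IsCell lam mu p.1 p.2 ∧ T.entry p.1 p.2 = m + 1 ∧
      (p.1 < i ∨ (p.1 = i ∧ j ≤ p.2))} :=
    (hfin.subset fun p hp => hp.1 : {p : ℕ × ℕ | IsCell lam mu p.1 p.2 ∧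
      T.entry p.1 p.2 = m + 1 ∧ (p.1 < i ∨ (p.1 = i ∧ j ≤ p.2))}.Finite)
  have : Nonempty {p : ℕ × ℕ // IsCell lam mu p.1 p.2 ∧ T.entry p.1 p.2 = m + 1 ∧
      (p.1 < i ∨ (p.1 = i ∧ j ≤ p.2))} := ⟨⟨(i, j), hc, he, .inr ⟨rfl, le_rfl⟩⟩⟩
  obtain ⟨⟨⟨⟨i', j'⟩, hc', he', h⟩⟩, -⟩ := Nat.card_pos_iff.1 (Nat.card_pos.trans_le hl)
  dsimp only at hc' he' h
  rcases h with h | ⟨rfl, h⟩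
  · exact ⟨i', j', h, hc', he'⟩
  · have := T.row_weak i' j j' h hc hc'
    omega

/-- If `nu (m - 1) = 0`, then no entry equals `m`. -/
theorem entry_ne (T : LRTableau lam mu nu)
    (hfin : {p : ℕ × ℕ | IsCell lam mu p.1 p.2}.Finite) {i j m : ℕ} (hm : 1 ≤ m)
    (hc : IsCell lam mu i j) (h0 : nu (m - 1) = 0) : T.entry i j ≠ m := by
  intro he
  have : Finite {p : ℕ × ℕ // IsCell lam mu p.1 p.2 ∧ T.entry p.1 p.2 = m} :=
    (hfin.subset fun p hp => hp.1 : {p : ℕ × ℕ | IsCell lam mu p.1 p.2 ∧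
      T.entry p.1 p.2 = m}.Finite)
  have : Nonempty {p : ℕ × ℕ // IsCell lam mu p.1 p.2 ∧ T.entry p.1 p.2 = m} :=
    ⟨⟨(i, j), hc, he⟩⟩
  have := T.content m hm
  have := Nat.card_pos (α := {p : ℕ × ℕ // IsCell lam mu p.1 p.2 ∧ T.entry p.1 p.2 = m})
  omega

/-- If `nu (m - 1) ≠ 0`, then some entry equals `m`. -/
theorem exists_entry (T : LRTableau lam mu nu) {m : ℕ} (hm : 1 ≤ m) (h0 : nu (m - 1) ≠ 0) :
    ∃ i j, IsCell lam mu i j ∧ T.entry i j = m := by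
  have h := T.content m hm
  obtain ⟨⟨⟨⟨i, j⟩, h⟩⟩, -⟩ := Nat.card_pos_iff.1 (h ▸ Nat.pos_of_ne_zero h0)
  exact ⟨i, j, h⟩

/-- A tableau whose `m`-entries include one in each column of an interval of length
`nu (m - 1)` has no further `m`-entries. -/
theorem eq_of_entry_eq (T : LRTableau lam mu nu)
    (hfin : {p : ℕ × ℕ | IsCell lam mu p.1 p.2}.Finite) {m : ℕ} (hm : 1 ≤ m)
    (a b : ℕ) (r : ℕ → ℕ) (hab : nu (m - 1) = b - a)
    (h : ∀ j, a ≤ j → j < b → IsCell lam mu (r j) j ∧ T.entry (r j) j = m)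
    {i j : ℕ} (hc : IsCell lam mu i j) (he : T.entry i j = m) :
    a ≤ j ∧ j < b ∧ i = r j := by
  set S : Set (ℕ × ℕ) := {p | IsCell lam mu p.1 p.2 ∧ T.entry p.1 p.2 = m}
  have hS : S.Finite := hfin.subset fun p hp => hp.1
  have hcard : S.ncard = b - a := (T.content m hm).trans hab
  have hinj : Function.Injective fun j => (r j, j) := fun x y hxy => (Prod.ext_iff.1 hxy).2
  have hsub : (fun j => (r j, j)) '' (Finset.Ico a b : Set ℕ) ⊆ S := by
    rintro _ ⟨x, hx, rfl⟩
    rw [Finset.mem_coe, Finset.mem_Ico] at hx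
    exact h x hx.1 hx.2
  have heq := Set.eq_of_subset_of_ncard_le hsub (by
    rw [hcard, Set.ncard_image_of_injective _ hinj, Set.ncard_coe_finset, Nat.card_Ico]) hS
  have hmem : (i, j) ∈ S := ⟨hc, he⟩
  rw [← heq] at hmem
  obtain ⟨x, hx, hxy⟩ := hmem
  rw [Finset.mem_coe, Finset.mem_Ico] at hx
  obtain ⟨rfl, rfl⟩ := Prod.ext_iff.1 hxy
  exact ⟨hx.1, hx.2, rfl⟩

end LRTableau

/-- A criterion for `lrCoeff lam mu nu = 1`: the filling `v` is a Littlewood–Richardson tableau,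
whose `m`-entries are the cells `(r m j, j)` with `a m ≤ j < b m`, and where `g m` matches
each entry `m + 1` with an entry `m` in a higher row; and it is the only one. -/
theorem lrCoeff_eq_one {lam mu nu : ℕ → ℕ}
    (hfin : {p : ℕ × ℕ | IsCell lam mu p.1 p.2}.Finite)
    (v : ℕ → ℕ → ℕ) (a b : ℕ → ℕ) (r : ℕ → ℕ → ℕ) (g : ℕ → ℕ × ℕ → ℕ × ℕ)
    (pos : ∀ i j, IsCell lam mu i j → 1 ≤ v i j)
    (row : ∀ i j j', j ≤ j' → IsCell lam mu i j → IsCell lam mu i j' → v i j ≤ v i j')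
    (col : ∀ i i' j, i < i' → IsCell lam mu i j → IsCell lam mu i' j → v i j < v i' j)
    (hab : ∀ m, 1 ≤ m → nu (m - 1) = b m - a m)
    (hcount : ∀ m i j, 1 ≤ m →
      (IsCell lam mu i j ∧ v i j = m ↔ a m ≤ j ∧ j < b m ∧ i = r m j))
    (hg : ∀ m i j, 1 ≤ m → IsCell lam mu i j → v i j = m + 1 →
      (g m (i, j)).1 < i ∧ IsCell lam mu (g m (i, j)).1 (g m (i, j)).2 ∧
        v (g m (i, j)).1 (g m (i, j)).2 = m)
    (hginj : ∀ m i j i' j', 1 ≤ m → IsCell lam mu i j → v i j = m + 1 →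
      IsCell lam mu i' j' → v i' j' = m + 1 → g m (i, j) = g m (i', j') → i = i' ∧ j = j')
    (uniq : ∀ (T : LRTableau lam mu nu) i j, IsCell lam mu i j → T.entry i j = v i j) :
    lrCoeff lam mu nu = 1 := by
  classical
  let f : ℕ → ℕ → ℕ := fun i j => if IsCell lam mu i j then v i j else 0
  have hf : ∀ {i j}, IsCell lam mu i j → f i j = v i j := fun h => if_pos h
  let T₀ : LRTableau lam mu nu :=
    { entry := f
      pos := fun i j h => by rw [hf h]; exact pos i j h
      zero := fun i j h => if_neg h
      row_weak := fun i j j' hj h h' => by rw [hf h, hf h']; exact row i j j' hj h h'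
      col_strict := fun i i' j hi h h' => by rw [hf h, hf h']; exact col i i' j hi h h'
      content := fun m hm => by
        have hinj : Function.Injective fun j => (r m j, j) :=
          fun x y hxy => (Prod.ext_iff.1 hxy).2
        have : {p : ℕ × ℕ | IsCell lam mu p.1 p.2 ∧ f p.1 p.2 = m} =
            (fun j => (r m j, j)) '' (Finset.Ico (a m) (b m) : Set ℕ) := by
          ext ⟨i, j⟩
          have hiff : IsCell lam mu i j ∧ f i j = m ↔ IsCell lam mu i j ∧ v i j = m :=
            and_congr_right fun h => by rw [hf h]
          simp only [Set.mem_ofPred_eq, hiff, hcount m i j hm, Set.mem_image, Finset.mem_coe,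
            Finset.mem_Ico, Prod.mk.injEq]
          constructor
          · rintro ⟨h1, h2, rfl⟩
            exact ⟨j, ⟨h1, h2⟩, rfl, rfl⟩
          · rintro ⟨x, ⟨h1, h2⟩, rfl, rfl⟩
            exact ⟨h1, h2, rfl⟩
        change Set.ncard {p : ℕ × ℕ | IsCell lam mu p.1 p.2 ∧ f p.1 p.2 = m} = _
        rw [this, Set.ncard_image_of_injective _ hinj, Set.ncard_coe_finset, Nat.card_Ico,
          hab m hm]
      lattice := fun i j m hm => by
        refine Set.ncard_le_ncard_of_injOn (g m) (s := {p : ℕ × ℕ | IsCell lam mu p.1 p.2 ∧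
          f p.1 p.2 = m + 1 ∧ (p.1 < i ∨ (p.1 = i ∧ j ≤ p.2))}) (t := {p : ℕ × ℕ |
          IsCell lam mu p.1 p.2 ∧ f p.1 p.2 = m ∧ (p.1 < i ∨ (p.1 = i ∧ j ≤ p.2))}) ?_ ?_
          (hfin.subset fun p hp => hp.1)
        · rintro ⟨x, y⟩ ⟨h1, h2, h3⟩
          dsimp only at h1 h2 h3
          rw [hf h1] at h2
          obtain ⟨h4, h5, h6⟩ := hg m x y hm h1 h2
          exact ⟨h5, (hf h5).trans h6, by omega⟩
        · rintro ⟨x, y⟩ ⟨h1, h2, -⟩ ⟨x', y'⟩ ⟨h1', h2', -⟩ he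
          dsimp only at h1 h2 h1' h2'
          rw [hf h1] at h2
          rw [hf h1'] at h2'
          exact Prod.ext_iff.2 (hginj m x y x' y' hm h1 h2 h1' h2' he) }
  refine Nat.card_eq_one_iff_unique.2 ⟨⟨fun T S => LRTableau.ext_of_cells fun i j h => ?_⟩, ⟨T₀⟩⟩
  rw [uniq T i j h, uniq S i j h]

/-- Without three nonempty rows of `lam / mu` in which to place a chain `1, 2, 3`, the
coefficient vanishes as soon as `nu` has at least three parts. -/
theorem lrCoeff_eq_zero_of_rows {lam mu nu : ℕ → ℕ}
    (hfin : {p : ℕ × ℕ | IsCell lam mu p.1 p.2}.Finite) (hnu : nu 2 ≠ 0) (x y : ℕ)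
    (hrow : ∀ i j, IsCell lam mu i j → i = x ∨ i = y) : lrCoeff lam mu nu = 0 := by
  have : IsEmpty (LRTableau lam mu nu) := by
    refine ⟨fun T => ?_⟩
    obtain ⟨i, j, hc, he⟩ := T.exists_entry (m := 3) (by norm_num) hnu
    obtain ⟨i', j', hi, hc', he'⟩ := T.exists_above hfin (by norm_num) hc he
    obtain ⟨i'', j'', hi', hc'', -⟩ := T.exists_above hfin (by norm_num) hc' he'
    have := hrow _ _ hc
    have := hrow _ _ hc'
    have := hrow _ _ hc''
    omega
  exact Nat.card_of_isEmpty

/-- The partition `(2k, k, k)`. -/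
def betaHook (k : ℕ) : ℕ → ℕ := fun i => if i = 0 then 2 * k else if i < 3 then k else 0

/-- The partition `(k, k, k, k)`. -/
def betaRect (k : ℕ) : ℕ → ℕ := fun i => if i < 4 then k else 0

theorem finite_betaHook (k : ℕ) (mu : ℕ → ℕ) :
    {p : ℕ × ℕ | IsCell (betaHook k) mu p.1 p.2}.Finite := by
  refine (Finset.range 3 ×ˢ Finset.range (2 * k)).finite_toSet.subset ?_
  rintro ⟨i, j⟩ ⟨-, h⟩
  simp only [betaHook] at h
  simp only [Finset.coe_product, Set.mem_prod, Finset.mem_coe, Finset.mem_range]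
  split_ifs at h <;> omega

theorem finite_betaRect (k : ℕ) (mu : ℕ → ℕ) :
    {p : ℕ × ℕ | IsCell (betaRect k) mu p.1 p.2}.Finite := by
  refine (Finset.range 4 ×ˢ Finset.range k).finite_toSet.subset ?_
  rintro ⟨i, j⟩ ⟨-, h⟩
  simp only [betaRect] at h
  simp only [Finset.coe_product, Set.mem_prod, Finset.mem_coe, Finset.mem_range]
  split_ifs at h <;> omega

theorem isCell_betaHook_kkone2 {k i j : ℕ} (hk : 3 ≤ k) :
    IsCell (betaHook k) (kkone2 k) i j ↔
      i = 0 ∧ k ≤ j ∧ j < 2 * k ∨ i = 1 ∧ j = k - 1 ∨ i = 2 ∧ 1 ≤ j ∧ j < k := by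
  simp only [IsCell, betaHook, kkone2]
  split_ifs <;> omega

theorem isCell_betaHook_kkone3 {k i j : ℕ} :
    IsCell (betaHook k) (kkone3 k) i j ↔ i = 0 ∧ k ≤ j ∧ j < 2 * k ∨ i = 2 ∧ j < k := by
  simp only [IsCell, betaHook, kkone3]
  split_ifs <;> omega

theorem isCell_betaHook_kkone {k i j : ℕ} :
    IsCell (betaHook k) (kkone k) i j ↔
      i = 0 ∧ k ≤ j ∧ j < 2 * k ∨ i = 2 ∧ 1 ≤ j ∧ j < k := by
  simp only [IsCell, betaHook, kkone]
  split_ifs <;> omega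

theorem isCell_betaRect_kkone2 {k i j : ℕ} (hk : 3 ≤ k) :
    IsCell (betaRect k) (kkone2 k) i j ↔
      i = 1 ∧ j = k - 1 ∨ i = 2 ∧ 1 ≤ j ∧ j < k ∨ i = 3 ∧ j < k := by
  simp only [IsCell, betaRect, kkone2]
  split_ifs <;> omega

theorem isCell_betaRect_kkone3 {k i j : ℕ} :
    IsCell (betaRect k) (kkone3 k) i j ↔ i = 2 ∧ j < k ∨ i = 3 ∧ j < k := by
  simp only [IsCell, betaRect, kkone3]
  split_ifs <;> omega

theorem isCell_betaRect_kkone {k i j : ℕ} :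
    IsCell (betaRect k) (kkone k) i j ↔ i = 2 ∧ 1 ≤ j ∧ j < k ∨ i = 3 ∧ j < k := by
  simp only [IsCell, betaRect, kkone]
  split_ifs <;> omega

section Hook

variable {k : ℕ} {mu nu : ℕ → ℕ}

/-- The top row of a Littlewood–Richardson tableau consists of ones. -/
theorem LRTableau.entry_row_zero {lam : ℕ → ℕ} (T : LRTableau lam mu nu)
    (hfin : {p : ℕ × ℕ | IsCell lam mu p.1 p.2}.Finite) {j : ℕ} (hc : IsCell lam mu 0 j) :
    T.entry 0 j = 1 := by
  have hp := T.pos 0 j hc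
  by_contra hne
  obtain ⟨i', j', hi, -⟩ := T.exists_above hfin (m := T.entry 0 j - 1) (by omega) hc (by omega)
  omega

/-- If `mu 0 = nu 0 = k`, the ones of a tableau of shape `betaHook k / mu` and content `nu`
fill the top row. -/
theorem LRTableau.two_le_entry (T : LRTableau (betaHook k) mu nu) (hmu : mu 0 = k)
    (hnu : nu 0 = k) {i j : ℕ} (hc : IsCell (betaHook k) mu i j) (hi : i ≠ 0) :
    2 ≤ T.entry i j := by
  have hp := T.pos i j hc
  by_contra hlt
  refine hi (T.eq_of_entry_eq (finite_betaHook k mu) le_rfl k (2 * k) (fun _ => 0) ?_ ?_ hc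
    (by omega)).2.2
  · change nu 0 = _
    omega
  · intro j h1 h2
    have hc' : IsCell (betaHook k) mu 0 j := ⟨by omega, by simpa [betaHook] using h2⟩
    exact ⟨hc', T.entry_row_zero (finite_betaHook k mu) hc'⟩

theorem lrCoeff_betaHook_kkone2_kkone3 (hk : 3 ≤ k) :
    lrCoeff (betaHook k) (kkone2 k) (kkone3 k) = 0 := by
  have : IsEmpty (LRTableau (betaHook k) (kkone2 k) (kkone3 k)) := by
    refine ⟨fun T => ?_⟩
    have hfin := finite_betaHook k (kkone2 k)
    have c1 : IsCell (betaHook k) (kkone2 k) 1 (k - 1) := by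
      rw [isCell_betaHook_kkone2 hk]; omega
    have c2 : IsCell (betaHook k) (kkone2 k) 2 (k - 1) := by
      rw [isCell_betaHook_kkone2 hk]; omega
    have h1 := T.two_le_entry (by simp [kkone2]) (by simp [kkone3]) c1 (by norm_num)
    have h2 := T.col_strict 1 2 (k - 1) (by norm_num) c1 c2
    exact T.entry_ne hfin (m := T.entry 2 (k - 1)) (by omega) c2
      (by simp only [kkone3]; split_ifs <;> omega) rfl
  exact Nat.card_of_isEmpty

theorem lrCoeff_betaHook_kkone2_kkone2 (hk : 3 ≤ k) :
    lrCoeff (betaHook k) (kkone2 k) (kkone2 k) = 1 := by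
  have hfin := finite_betaHook k (kkone2 k)
  refine lrCoeff_eq_one hfin
    (fun i j => if i = 0 then 1 else if i = 2 ∧ j = k - 1 then 3 else 2)
    (fun m => if m = 1 then k else if m = 2 then 1 else if m = 3 then k - 1 else 0)
    (fun m => if m = 1 then 2 * k else if m ≤ 3 then k else 0)
    (fun m j => if m = 1 then 0 else if m = 2 ∧ j = k - 1 then 1 else 2)
    (fun m p => if m = 1 then (0, k + p.2) else (1, k - 1)) ?_ ?_ ?_ ?_ ?_ ?_ ?_ ?_
  · grind
  · grind [isCell_betaHook_kkone2]
  · grind [isCell_betaHook_kkone2]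
  · grind [kkone2]
  · grind [isCell_betaHook_kkone2]
  · grind [isCell_betaHook_kkone2]
  · grind [isCell_betaHook_kkone2]
  · intro T i j hc
    have c1 : IsCell (betaHook k) (kkone2 k) 1 (k - 1) := by
      rw [isCell_betaHook_kkone2 hk]; omega
    have c2 : IsCell (betaHook k) (kkone2 k) 2 (k - 1) := by
      rw [isCell_betaHook_kkone2 hk]; omega
    have le3 : ∀ {i j}, IsCell (betaHook k) (kkone2 k) i j → T.entry i j ≤ 3 := by
      intro i j hc
      by_contra hlt
      exact T.entry_ne hfin (m := T.entry i j) (by omega) hc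
        (by simp only [kkone2]; split_ifs <;> omega) rfl
    have ge2 : ∀ {i j}, IsCell (betaHook k) (kkone2 k) i j → i ≠ 0 → 2 ≤ T.entry i j :=
      T.two_le_entry (by simp [kkone2]) (by simp [kkone2])
    have h2 : T.entry 2 (k - 1) = 3 := by
      have := T.col_strict 1 2 (k - 1) (by norm_num) c1 c2
      have := ge2 c1 (by norm_num)
      have := le3 c2
      omega
    have h3 : ∀ {i j}, IsCell (betaHook k) (kkone2 k) i j → T.entry i j = 3 →
        k - 1 ≤ j ∧ j < k ∧ i = 2 := by
      refine T.eq_of_entry_eq hfin (by norm_num) (k - 1) k (fun _ => 2) ?_ ?_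
      · simp only [kkone2]; norm_num; omega
      · intro j _ _
        obtain rfl : j = k - 1 := by omega
        exact ⟨c2, h2⟩
    by_cases hi : i = 0
    · subst hi
      exact T.entry_row_zero hfin hc
    · have := ge2 hc hi
      have := le3 hc
      have := h3 hc
      grind

theorem lrCoeff_betaHook_kkone3_kkone3 :
    lrCoeff (betaHook k) (kkone3 k) (kkone3 k) = 1 := by
  have hfin := finite_betaHook k (kkone3 k)
  refine lrCoeff_eq_one hfin (fun i j => if i = 0 then 1 else 2)
    (fun m => if m = 1 then k else 0)
    (fun m => if m = 1 then 2 * k else if m = 2 then k else 0)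
    (fun m _ => if m = 1 then 0 else 2)
    (fun _ p => (0, k + p.2)) ?_ ?_ ?_ ?_ ?_ ?_ ?_ ?_
  · grind
  · grind [isCell_betaHook_kkone3]
  · grind [isCell_betaHook_kkone3]
  · grind [kkone3]
  · grind [isCell_betaHook_kkone3]
  · grind [isCell_betaHook_kkone3]
  · grind [isCell_betaHook_kkone3]
  · intro T i j hc
    by_cases hi : i = 0
    · subst hi
      exact T.entry_row_zero hfin hc
    · have := T.two_le_entry (by simp [kkone3]) (by simp [kkone3]) hc hi
      have : T.entry i j ≤ 2 := by
        by_contra hlt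
        exact T.entry_ne hfin (m := T.entry i j) (by omega) hc
          (by simp only [kkone3]; split_ifs <;> omega) rfl
      rw [if_neg hi]
      omega

theorem lrCoeff_betaHook_kkone_kkone23 (hk : 3 ≤ k) :
    lrCoeff (betaHook k) (kkone k) (kkone23 k) = 1 := by
  have hfin := finite_betaHook k (kkone k)
  refine lrCoeff_eq_one hfin (fun i j => if i = 0 then 1 else 2)
    (fun m => if m = 1 then k else if m = 2 then 1 else 0)
    (fun m => if m = 1 then 2 * k else if m = 2 then k else 0)
    (fun m _ => if m = 1 then 0 else 2)
    (fun _ p => (0, k + p.2)) ?_ ?_ ?_ ?_ ?_ ?_ ?_ ?_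
  · grind
  · grind [isCell_betaHook_kkone]
  · grind [isCell_betaHook_kkone]
  · grind [kkone23]
  · grind [isCell_betaHook_kkone]
  · grind [isCell_betaHook_kkone]
  · grind [isCell_betaHook_kkone]
  · intro T i j hc
    by_cases hi : i = 0
    · subst hi
      exact T.entry_row_zero hfin hc
    · have := T.two_le_entry (by simp [kkone]) (by simp [kkone23]) hc hi
      have : T.entry i j ≤ 2 := by
        by_contra hlt
        exact T.entry_ne hfin (m := T.entry i j) (by omega) hc
          (by simp only [kkone23]; split_ifs <;> omega) rfl
      rw [if_neg hi]
      omega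

end Hook

section Rect

variable {k : ℕ}

theorem lrCoeff_betaRect_kkone2_kkone3 (hk : 3 ≤ k) :
    lrCoeff (betaRect k) (kkone2 k) (kkone3 k) = 0 := by
  have : IsEmpty (LRTableau (betaRect k) (kkone2 k) (kkone3 k)) := by
    refine ⟨fun T => ?_⟩
    have c1 : IsCell (betaRect k) (kkone2 k) 1 (k - 1) := by
      rw [isCell_betaRect_kkone2 hk]; omega
    have c2 : IsCell (betaRect k) (kkone2 k) 2 (k - 1) := by
      rw [isCell_betaRect_kkone2 hk]; omega
    have c3 : IsCell (betaRect k) (kkone2 k) 3 (k - 1) := by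
      rw [isCell_betaRect_kkone2 hk]; omega
    have h1 := T.pos _ _ c1
    have h2 := T.col_strict 1 2 (k - 1) (by norm_num) c1 c2
    have h3 := T.col_strict 2 3 (k - 1) (by norm_num) c2 c3
    exact T.entry_ne (finite_betaRect k (kkone2 k)) (m := T.entry 3 (k - 1)) (by omega) c3
      (by simp only [kkone3]; split_ifs <;> omega) rfl
  exact Nat.card_of_isEmpty

theorem lrCoeff_betaRect_kkone2_kkone2 (hk : 3 ≤ k) :
    lrCoeff (betaRect k) (kkone2 k) (kkone2 k) = 1 := by
  have hfin := finite_betaRect k (kkone2 k)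
  refine lrCoeff_eq_one hfin
    (fun i j => if j = k - 1 then i else if j = 0 then 1 else i - 1)
    (fun m => if m = 2 then 1 else if m = 3 then k - 1 else 0)
    (fun m => if m ≤ 3 then k else 0)
    (fun m j => if j = k - 1 then m else if j = 0 then 3 else m + 1)
    (fun _ p => (p.1 - 1, p.2)) ?_ ?_ ?_ ?_ ?_ ?_ ?_ ?_
  · grind [isCell_betaRect_kkone2]
  · grind [isCell_betaRect_kkone2]
  · grind [isCell_betaRect_kkone2]
  · grind [kkone2]
  · grind [isCell_betaRect_kkone2]
  · grind [isCell_betaRect_kkone2]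
  · grind [isCell_betaRect_kkone2]
  · intro T i j hc
    have cell : ∀ {i j}, i = 1 ∧ j = k - 1 ∨ i = 2 ∧ 1 ≤ j ∧ j < k ∨ i = 3 ∧ j < k →
        IsCell (betaRect k) (kkone2 k) i j := (isCell_betaRect_kkone2 hk).2
    have le3 : ∀ {i j}, IsCell (betaRect k) (kkone2 k) i j → T.entry i j ≤ 3 := by
      intro i j hc
      by_contra hlt
      exact T.entry_ne hfin (m := T.entry i j) (by omega) hc
        (by simp only [kkone2]; split_ifs <;> omega) rfl
    have last : T.entry 1 (k - 1) = 1 ∧ T.entry 2 (k - 1) = 2 ∧ T.entry 3 (k - 1) = 3 := by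
      have c1 : IsCell (betaRect k) (kkone2 k) 1 (k - 1) := cell (by omega)
      have c2 : IsCell (betaRect k) (kkone2 k) 2 (k - 1) := cell (by omega)
      have c3 : IsCell (betaRect k) (kkone2 k) 3 (k - 1) := cell (by omega)
      have := T.pos _ _ c1
      have := T.col_strict 1 2 (k - 1) (by norm_num) c1 c2
      have := T.col_strict 2 3 (k - 1) (by norm_num) c2 c3
      have := le3 c3
      omega
    have h3 : ∀ {i j}, IsCell (betaRect k) (kkone2 k) i j → T.entry i j = 3 →
        k - 1 ≤ j ∧ j < k ∧ i = 3 := by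
      refine T.eq_of_entry_eq hfin (by norm_num) (k - 1) k (fun _ => 3) ?_ ?_
      · simp only [kkone2]; norm_num; omega
      · intro j _ _
        obtain rfl : j = k - 1 := by omega
        exact ⟨cell (by omega), last.2.2⟩
    have mid : ∀ {j}, 1 ≤ j → j < k - 1 → T.entry 2 j = 1 ∧ T.entry 3 j = 2 := by
      intro j h1 h2
      have c2 : IsCell (betaRect k) (kkone2 k) 2 j := cell (by omega)
      have c3 : IsCell (betaRect k) (kkone2 k) 3 j := cell (by omega)
      have := T.pos _ _ c2
      have := T.col_strict 2 3 j (by norm_num) c2 c3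
      have := le3 c3
      have := h3 c3
      omega
    have h2 : ∀ {i j}, IsCell (betaRect k) (kkone2 k) i j → T.entry i j = 2 →
        1 ≤ j ∧ j < k ∧ i = if j = k - 1 then 2 else 3 := by
      refine T.eq_of_entry_eq hfin (by norm_num) 1 k (fun j => if j = k - 1 then 2 else 3) ?_ ?_
      · simp [kkone2]
      · intro j h1 h2
        by_cases hj : j = k - 1
        · subst hj
          rw [if_pos rfl]
          exact ⟨cell (by omega), last.2.1⟩
        · rw [if_neg hj]
          exact ⟨cell (by omega), (mid h1 (by omega)).2⟩
    have := T.pos _ _ hc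
    have := le3 hc
    have := h3 hc
    have := h2 hc
    have := (isCell_betaRect_kkone2 hk).1 hc
    grind

theorem lrCoeff_betaRect_kkone3_kkone3 :
    lrCoeff (betaRect k) (kkone3 k) (kkone3 k) = 1 := by
  have hfin := finite_betaRect k (kkone3 k)
  refine lrCoeff_eq_one hfin (fun i _ => i - 1) (fun _ => 0)
    (fun m => if m ≤ 2 then k else 0) (fun m _ => m + 1)
    (fun _ p => (p.1 - 1, p.2)) ?_ ?_ ?_ ?_ ?_ ?_ ?_ ?_
  · grind [isCell_betaRect_kkone3]
  · grind [isCell_betaRect_kkone3]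
  · grind [isCell_betaRect_kkone3]
  · grind [kkone3]
  · grind [isCell_betaRect_kkone3]
  · grind [isCell_betaRect_kkone3]
  · grind [isCell_betaRect_kkone3]
  · intro T i j hc
    have hj : j < k := by rw [isCell_betaRect_kkone3] at hc; omega
    have c2 : IsCell (betaRect k) (kkone3 k) 2 j := isCell_betaRect_kkone3.2 (by omega)
    have c3 : IsCell (betaRect k) (kkone3 k) 3 j := isCell_betaRect_kkone3.2 (by omega)
    have := T.pos _ _ c2
    have := T.col_strict 2 3 j (by norm_num) c2 c3
    have : T.entry 3 j ≤ 2 := by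
      by_contra hlt
      exact T.entry_ne hfin (m := T.entry 3 j) (by omega) c3
        (by simp only [kkone3]; split_ifs <;> omega) rfl
    grind [isCell_betaRect_kkone3]

theorem lrCoeff_betaRect_kkone_kkone23 (hk : 3 ≤ k) :
    lrCoeff (betaRect k) (kkone k) (kkone23 k) = 1 := by
  have hfin := finite_betaRect k (kkone k)
  refine lrCoeff_eq_one hfin (fun i j => if j = 0 then 1 else i - 1)
    (fun m => if m = 2 then 1 else 0) (fun m => if m ≤ 2 then k else 0)
    (fun m j => if j = 0 then 3 else m + 1)
    (fun _ p => (p.1 - 1, p.2)) ?_ ?_ ?_ ?_ ?_ ?_ ?_ ?_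
  · grind [isCell_betaRect_kkone]
  · grind [isCell_betaRect_kkone]
  · grind [isCell_betaRect_kkone]
  · grind [kkone23]
  · grind [isCell_betaRect_kkone]
  · grind [isCell_betaRect_kkone]
  · grind [isCell_betaRect_kkone]
  · intro T i j hc
    have le2 : ∀ {i j}, IsCell (betaRect k) (kkone k) i j → T.entry i j ≤ 2 := by
      intro i j hc
      by_contra hlt
      exact T.entry_ne hfin (m := T.entry i j) (by omega) hc
        (by simp only [kkone23]; split_ifs <;> omega) rfl
    have col : ∀ {j}, 1 ≤ j → j < k → T.entry 2 j = 1 ∧ T.entry 3 j = 2 := by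
      intro j h1 h2
      have c2 : IsCell (betaRect k) (kkone k) 2 j := isCell_betaRect_kkone.2 (by omega)
      have c3 : IsCell (betaRect k) (kkone k) 3 j := isCell_betaRect_kkone.2 (by omega)
      have := T.pos _ _ c2
      have := T.col_strict 2 3 j (by norm_num) c2 c3
      have := le2 c3
      omega
    have h2 : ∀ {i j}, IsCell (betaRect k) (kkone k) i j → T.entry i j = 2 →
        1 ≤ j ∧ j < k ∧ i = 3 := by
      refine T.eq_of_entry_eq hfin (by norm_num) 1 k (fun _ => 3) ?_ ?_
      · simp [kkone23]
      · intro j h1 h2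
        exact ⟨isCell_betaRect_kkone.2 (by omega), (col h1 h2).2⟩
    have := T.pos _ _ hc
    have := le2 hc
    have := h2 hc
    have := isCell_betaRect_kkone.1 hc
    grind

end Rect

/-- for `λ = (k, k, 1)` with `k ≥ 3` and each of `β₁ = (2k, k, k)`,
`β₂ = (k, k, k, k)`, the Littlewood–Richardson coefficients
`c^β_{λ_(2), λ_(3)}, c^β_{λ_(2), λ_(2)}, c^β_{λ_(3), λ_(3)}, c^β_{λ, λ_(2,3)},
c^β_{λ, λ_(2,↑)}, c^β_{λ, λ_(2,←)}` are `0, 1, 1, 1, 0, 0` respectively. -/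
theorem kk1_lr_special (k : ℕ) (hk : 3 ≤ k) (β : ℕ → ℕ)
    (hβ : β = (fun i => if i = 0 then 2 * k else if i < 3 then k else 0) ∨
      β = fun i => if i < 4 then k else 0) :
    lrCoeff β (kkone2 k) (kkone3 k) = 0 ∧
    lrCoeff β (kkone2 k) (kkone2 k) = 1 ∧
    lrCoeff β (kkone3 k) (kkone3 k) = 1 ∧
    lrCoeff β (kkone k) (kkone23 k) = 1 ∧
    lrCoeff β (kkone k) (kkoneUp k) = 0 ∧
    lrCoeff β (kkone k) (kkoneLeft k) = 0 := by
  rcases hβ with rfl | rfl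
  · have hrow : ∀ i j, IsCell (betaHook k) (kkone k) i j → i = 0 ∨ i = 2 := fun i j h => by
      rw [isCell_betaHook_kkone] at h; omega
    exact ⟨lrCoeff_betaHook_kkone2_kkone3 hk, lrCoeff_betaHook_kkone2_kkone2 hk,
      lrCoeff_betaHook_kkone3_kkone3, lrCoeff_betaHook_kkone_kkone23 hk,
      lrCoeff_eq_zero_of_rows (finite_betaHook k _) (by simp [kkoneUp]) 0 2 hrow,
      lrCoeff_eq_zero_of_rows (finite_betaHook k _) (by simp [kkoneLeft]) 0 2 hrow⟩
  · have hrow : ∀ i j, IsCell (betaRect k) (kkone k) i j → i = 2 ∨ i = 3 := fun i j h => by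
      rw [isCell_betaRect_kkone] at h; omega
    exact ⟨lrCoeff_betaRect_kkone2_kkone3 hk, lrCoeff_betaRect_kkone2_kkone2 hk,
      lrCoeff_betaRect_kkone3_kkone3, lrCoeff_betaRect_kkone_kkone23 hk,
      lrCoeff_eq_zero_of_rows (finite_betaRect k _) (by simp [kkoneUp]) 2 3 hrow,
      lrCoeff_eq_zero_of_rows (finite_betaRect k _) (by simp [kkoneLeft]) 2 3 hrow⟩

end
end

section
/- Let k ≥ 3, let λ' = (3, 2^{k−1}), and set λ'_{(1)} = (2^k), λ'_{(k)} = (3, 2^{k−2}, 1), λ'_{(1,k)} = (2^{k−1}, 1). Then for every partition α' of 4k = 2|λ'| − 2 that contains λ' and is not equal to (3^k, 1^k) or (4^k), the Littlewood–Richardson coefficients satisfy 2·c^{α'}_{λ'_{(1)}, λ'_{(k)}} ≥ c^{α'}_{λ', λ'_{(1,k)}}. -/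
noncomputable section

/-- The partition `λ' = (3, 2^(k-1))`. -/
def lamC (k : ℕ) : ℕ → ℕ := fun i => if i = 0 then 3 else if i < k then 2 else 0

/-- `λ'_(1) = (2^k)` for `λ' = (3, 2^(k-1))`. -/
def lamC1 (k : ℕ) : ℕ → ℕ := fun i => if i < k then 2 else 0

/-- `λ'_(k) = (3, 2^(k-2), 1)` for `λ' = (3, 2^(k-1))`. -/
def lamCK (k : ℕ) : ℕ → ℕ :=
  fun i => if i = 0 then 3 else if i < k - 1 then 2 else if i < k then 1 else 0

/-- `λ'_(1,k) = (2^(k-1), 1)` for `λ' = (3, 2^(k-1))`. -/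
def lamC1K (k : ℕ) : ℕ → ℕ := fun i => if i < k - 1 then 2 else if i < k then 1 else 0

open Finset

open Classical in
/-- A family of pairs with at most one pair in each column is counted by its nonempty columns. -/
lemma card_pairs_eq_card_columns (R : ℕ → ℕ → Prop) (J : ℕ)
    (huniq : ∀ i i' j, R i j → R i' j → i = i') (hJ : ∀ i j, R i j → j < J) :
    Nat.card {p : ℕ × ℕ // R p.1 p.2} = #{j ∈ range J | ∃ i, R i j} := by
  rw [← Fintype.card_coe, ← Nat.card_eq_fintype_card]
  refine Nat.card_congr (Equiv.ofBijective
    (fun p => ⟨p.1.2, by simpa using ⟨hJ _ _ p.2, p.1.1, p.2⟩⟩) ⟨?_, ?_⟩)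
  · rintro ⟨⟨i, j⟩, h⟩ ⟨⟨i', j'⟩, h'⟩ he
    obtain rfl : j = j' := by simpa using he
    obtain rfl := huniq _ _ _ h h'
    rfl
  · rintro ⟨j, hj⟩
    obtain ⟨i, hi⟩ := (mem_filter.1 hj).2
    exact ⟨⟨(i, j), hi⟩, rfl⟩

open Classical in
lemma card_pairs_eq_sum_five (R : ℕ → ℕ → Prop)
    (huniq : ∀ i i' j, R i j → R i' j → i = i') (hJ : ∀ i j, R i j → j < 5) :
    Nat.card {p : ℕ × ℕ // R p.1 p.2} =
      (if ∃ i, R i 0 then 1 else 0) + (if ∃ i, R i 1 then 1 else 0) +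
      (if ∃ i, R i 2 then 1 else 0) + (if ∃ i, R i 3 then 1 else 0) +
      (if ∃ i, R i 4 then 1 else 0) := by
  rw [card_pairs_eq_card_columns R 5 huniq hJ, card_filter]
  simp only [sum_range_succ, sum_range_zero, zero_add]

/-- The column lengths (conjugate partition) of a partition. -/
lemma IsPartition.exists_colLen {α : ℕ → ℕ} (hα : IsPartition α) :
    ∃ n : ℕ → ℕ, ∀ i j, j < α i ↔ i < n j := by
  obtain ⟨ha, N, hN⟩ := hα
  have hex : ∀ j, ∃ i, α i ≤ j := fun j => ⟨N, by simp [hN N le_rfl]⟩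
  refine ⟨fun j => Nat.find (hex j), fun i j => ⟨fun h => ?_, fun h => ?_⟩⟩
  · by_contra! hc
    exact absurd ((ha hc).trans (Nat.find_spec (hex j))) (by omega)
  · simpa using Nat.find_min (hex j) h

lemma finsum_eq_sum_colLen {α n : ℕ → ℕ} (hn : ∀ i j, j < α i ↔ i < n j) (h5 : n 5 = 0) :
    ∑ᶠ i, α i = n 0 + n 1 + n 2 + n 3 + n 4 := by
  have hrow : ∀ i, α i = ∑ j ∈ range 5, if i < n j then 1 else 0 := by
    intro i
    have : α i ≤ 5 := by
      by_contra! h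
      have := (hn i 5).1 h
      omega
    rw [← card_filter]
    simp_rw [← hn i]
    have : ({j ∈ range 5 | j < α i} : Finset ℕ) = range (α i) := by
      ext j; simp; omega
    simp [this]
  have hsub : Function.support α ⊆ (range (n 0) : Finset ℕ) := by
    intro i hi
    have := (hn i 0).1 (Nat.pos_of_ne_zero hi)
    simpa using this
  have hle : ∀ j, n j ≤ n 0 := by
    intro j
    by_contra! h
    have h1 := (hn (n 0) j).2 h
    have h2 := (hn (n 0) 0).1 (by omega)
    omega
  rw [finsum_eq_sum_of_support_subset _ hsub, sum_congr rfl fun i _ => hrow i, sum_comm]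
  have : ∀ j, ∑ i ∈ range (n 0), (if i < n j then 1 else 0) = n j := by
    intro j
    rw [← card_filter]
    have : ({i ∈ range (n 0) | i < n j} : Finset ℕ) = range (n j) := by
      ext i; have := hle j; simp; omega
    simp [this]
  simp_rw [this]
  simp [sum_range_succ]

/-- A strictly increasing function on an interval is determined by its values. -/
lemma eq_of_strictMono_of_values {f g : ℕ → ℕ} {s e : ℕ}
    (hf : ∀ i i', s ≤ i → i < i' → i' < e → f i < f i')
    (hg : ∀ i i', s ≤ i → i < i' → i' < e → g i < g i')
    (h : ∀ m, (∃ i, (s ≤ i ∧ i < e) ∧ f i = m) ↔ ∃ i, (s ≤ i ∧ i < e) ∧ g i = m) :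
    ∀ i, s ≤ i → i < e → f i = g i := by
  intro i
  induction i using Nat.strong_induction_on with
  | _ i ih =>
    intro hs he
    obtain ⟨a, ha, hfa⟩ := (h (f i)).1 ⟨i, ⟨hs, he⟩, rfl⟩
    obtain ⟨b, hb, hgb⟩ := (h (g i)).2 ⟨i, ⟨hs, he⟩, rfl⟩
    rcases lt_trichotomy a i with hai | rfl | hai
    · have := ih a hai ha.1 ha.2
      have := hf a i ha.1 hai he
      omega
    · exact hfa.symm
    · have := hg i a hs hai ha.2
      rcases lt_trichotomy b i with hbi | rfl | hbi
      · have := ih b hbi hb.1 hb.2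
        have := hg b i hb.1 hbi he
        omega
      · exact hgb
      · have := hf i b hs hbi hb.2
        omega

namespace LRTableau

variable {lam mu nu : ℕ → ℕ}

@[ext]
lemma ext_entry {T T' : LRTableau lam mu nu} (h : ∀ i j, IsCell lam mu i j →
    T.entry i j = T'.entry i j) : T = T' := by
  have : T.entry = T'.entry := by
    funext i j
    by_cases hc : IsCell lam mu i j
    · exact h i j hc
    · rw [T.zero i j hc, T'.zero i j hc]
  cases T; cases T'; cases this; rfl

lemma eq_of_entry_eq_s14 (T : LRTableau lam mu nu) {i i' j : ℕ} (h : IsCell lam mu i j)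
    (h' : IsCell lam mu i' j) (he : T.entry i j = T.entry i' j) : i = i' := by
  rcases lt_trichotomy i i' with hlt | rfl | hlt
  · exact absurd (T.col_strict i i' j hlt h h') (by omega)
  · rfl
  · exact absurd (T.col_strict i' i j hlt h' h) (by omega)

lemma finite_cells (hlam : IsPartition lam) (P : ℕ × ℕ → Prop) :
    Finite {p : ℕ × ℕ // IsCell lam mu p.1 p.2 ∧ P p} := by
  obtain ⟨ha, N, hN⟩ := hlam
  refine Set.Finite.to_subtype (s := {p : ℕ × ℕ | IsCell lam mu p.1 p.2 ∧ P p})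
    (((Set.finite_Iio N).prod (Set.finite_Iio (lam 0))).subset ?_)
  rintro ⟨i, j⟩ ⟨⟨-, h⟩, -⟩
  refine ⟨?_, lt_of_lt_of_le h (ha (Nat.zero_le i))⟩
  by_contra hc
  have := hN i (by simpa using hc)
  simp at h
  omega

/-- Each entry `m + 1 ≥ 2` is preceded by an entry `m` in a strictly higher row. -/
lemma exists_pred (hlam : IsPartition lam) (T : LRTableau lam mu nu) {i j m : ℕ} (hm : 1 ≤ m)
    (hc : IsCell lam mu i j) (he : T.entry i j = m + 1) :
    ∃ i' j', i' < i ∧ IsCell lam mu i' j' ∧ T.entry i' j' = m := by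
  have hlat := T.lattice i j m hm
  have := finite_cells (mu := mu) hlam (fun p => T.entry p.1 p.2 = m + 1 ∧
    (p.1 < i ∨ (p.1 = i ∧ j ≤ p.2)))
  have hpos := Nat.card_pos_iff.2 ⟨⟨⟨(i, j), hc, he, Or.inr ⟨rfl, le_rfl⟩⟩⟩, this⟩
  obtain ⟨⟨⟨i', j'⟩, hc', he', hb⟩⟩ := (Nat.card_pos_iff.1 (hpos.trans_le hlat)).1
  rcases hb with hb | ⟨rfl, hb⟩
  · exact ⟨i', j', hb, hc', he'⟩
  · have := T.row_weak i' j j' hb hc hc'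
    dsimp only at he he' this
    omega

lemma entry_le (hlam : IsPartition lam) (T : LRTableau lam mu nu) {i j : ℕ}
    (hc : IsCell lam mu i j) : T.entry i j ≤ i + 1 := by
  induction i using Nat.strong_induction_on generalizing j with
  | _ i ih =>
    by_contra! h
    obtain ⟨i', j', hi, hc', he⟩ := T.exists_pred hlam (m := T.entry i j - 1) (by omega) hc
      (by omega)
    have := ih i' hi hc'
    omega

lemma content_pos (hlam : IsPartition lam) (T : LRTableau lam mu nu) {i j : ℕ}
    (hc : IsCell lam mu i j) : 0 < nu (T.entry i j - 1) := by
  rw [← T.content _ (T.pos i j hc)]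
  have := finite_cells (mu := mu) hlam (fun p => T.entry p.1 p.2 = T.entry i j)
  exact Nat.card_pos_iff.2 ⟨⟨⟨(i, j), hc, rfl⟩⟩, this⟩

lemma finite (hlam : IsPartition lam) : Finite (LRTableau lam mu nu) := by
  obtain ⟨N, hN⟩ := hlam.2
  let g : LRTableau lam mu nu → (Fin N × Fin (lam 0) → Fin (N + 1)) := fun T p =>
    ⟨min (T.entry p.1 p.2) N, by omega⟩
  refine Finite.of_injective g fun T T' h => ext_entry fun i j hc => ?_
  have hi : i < N := by
    by_contra hi
    have := hN i (by omega)
    have := hc.2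
    omega
  have hj : j < lam 0 := hc.2.trans_le (hlam.1 (Nat.zero_le i))
  have := congrArg Fin.val (congrFun h (⟨i, hi⟩, ⟨j, hj⟩))
  have h1 := T.entry_le hlam hc
  have h2 := T'.entry_le hlam hc
  simp only [g] at this
  omega

open Classical in
lemma content_eq_sum_five (T : LRTableau lam mu nu)
    (h5 : ∀ i j, IsCell lam mu i j → j < 5) (m : ℕ) (hm : 1 ≤ m) :
    (if ∃ i, IsCell lam mu i 0 ∧ T.entry i 0 = m then 1 else 0) +
    (if ∃ i, IsCell lam mu i 1 ∧ T.entry i 1 = m then 1 else 0) +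
    (if ∃ i, IsCell lam mu i 2 ∧ T.entry i 2 = m then 1 else 0) +
    (if ∃ i, IsCell lam mu i 3 ∧ T.entry i 3 = m then 1 else 0) +
    (if ∃ i, IsCell lam mu i 4 ∧ T.entry i 4 = m then 1 else 0) = nu (m - 1) := by
  rw [← T.content m hm, card_pairs_eq_sum_five (fun i j => IsCell lam mu i j ∧ T.entry i j = m)]
  · exact fun i i' j h h' => T.eq_of_entry_eq_s14 h.1 h'.1 (h.2.trans h'.2.symm)
  · exact fun i j h => h5 i j h.1

open Classical in
lemma lattice_sum_five (T : LRTableau lam mu nu)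
    (h5 : ∀ i j, IsCell lam mu i j → j < 5) (i j m : ℕ) (hm : 1 ≤ m) :
    let D : ℕ → ℕ → ℕ := fun j' a => if ∃ i', IsCell lam mu i' j' ∧ T.entry i' j' = a ∧
      (i' < i ∨ (i' = i ∧ j ≤ j')) then 1 else 0
    D 0 (m + 1) + D 1 (m + 1) + D 2 (m + 1) + D 3 (m + 1) + D 4 (m + 1) ≤
      D 0 m + D 1 m + D 2 m + D 3 m + D 4 m := by
  intro D
  have h := T.lattice i j m hm
  have key : ∀ a, Nat.card {p : ℕ × ℕ // IsCell lam mu p.1 p.2 ∧ T.entry p.1 p.2 = a ∧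
      (p.1 < i ∨ (p.1 = i ∧ j ≤ p.2))} = D 0 a + D 1 a + D 2 a + D 3 a + D 4 a := by
    intro a
    rw [card_pairs_eq_sum_five (fun i' j' => IsCell lam mu i' j' ∧ T.entry i' j' = a ∧
      (i' < i ∨ (i' = i ∧ j ≤ j')))]
    · exact fun i i' j h h' => T.eq_of_entry_eq_s14 h.1 h'.1 (h.2.1.trans h'.2.1.symm)
    · exact fun i j h => h5 i j h.1
  rwa [key, key] at h

end LRTableau

section ContentC1K

variable {k : ℕ} {α n : ℕ → ℕ}

lemma isCell_lamC_iff (hn : ∀ i j, j < α i ↔ i < n j) (hk : 1 ≤ k) (i j : ℕ) :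
    IsCell α (lamC k) i j ↔ i < n j ∧ (j < 2 → k ≤ i) ∧ (j = 2 → 1 ≤ i) := by
  rw [← hn, IsCell, lamC]
  split_ifs <;> omega

lemma isCell_lamC1_iff (hn : ∀ i j, j < α i ↔ i < n j) (i j : ℕ) :
    IsCell α (lamC1 k) i j ↔ i < n j ∧ (j < 2 → k ≤ i) := by
  rw [← hn, IsCell, lamC1]
  split_ifs <;> omega

lemma colLen_antitone (hn : ∀ i j, j < α i ↔ i < n j) : Antitone n := by
  intro j j' hjj
  by_contra! h
  have h1 := (hn (n j) j').2 h
  have h2 := (hn (n j) j).1 (by omega)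
  omega

/-- The possible shapes of the part of an LR tableau of shape `α / (3, 2^(k-1))` lying in
columns `2`, `3`, `4` of lengths `n₂, n₃, n₄`. Column `2` omits exactly the value `r`; the values
below `c` occur twice and those in `[c, b)` once. -/
def UpperShape (n₂ n₃ n₄ r c b : ℕ) : Prop :=
  (n₄ = 0 ∧ n₃ < n₂ ∧ r = n₂ ∧ c = n₃ + 1 ∧ b = n₂) ∨
  (n₄ = 1 ∧ 1 ≤ n₃ ∧ r = 1 ∧ c = n₃ + 1 ∧ b = n₂ + 1) ∨
  (n₄ = 0 ∧ 1 ≤ n₃ ∧ r = n₃ ∧ c = n₃ ∧ b = n₂ + 1)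

variable (hα : IsPartition α) (hn : ∀ i j, j < α i ↔ i < n j) (hk : 3 ≤ k)
  (T : LRTableau α (lamC k) (lamC1K k))

include hα in
lemma entry_le_k {i j : ℕ} (hc : IsCell α (lamC k) i j) : T.entry i j ≤ k := by
  have h := T.content_pos hα hc
  by_contra! hgt
  rw [lamC1K, if_neg (by omega), if_neg (by omega)] at h
  omega

include hα hn hk in
lemma entry_eq_succ {i j : ℕ} (hj : 3 ≤ j) (hi : i < n j) : T.entry i j = i + 1 := by
  have hcell : ∀ i, i < n j → IsCell α (lamC k) i j := fun i hi =>
    (isCell_lamC_iff hn (by omega) i j).2 ⟨hi, by omega, by omega⟩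
  refine le_antisymm (T.entry_le hα (hcell i hi)) ?_
  induction i with
  | zero => exact T.pos 0 j (hcell 0 hi)
  | succ i ih =>
    have := ih (by omega)
    have := T.col_strict i (i + 1) j (by omega) (hcell i (by omega)) (hcell _ hi)
    omega

include hα hn hk T in
lemma colLen_five_eq_zero : n 5 = 0 := by
  classical
  by_contra h5
  have hanti := colLen_antitone hn
  have h3 : n 5 ≤ n 3 := hanti (by omega)
  have h4 : n 5 ≤ n 4 := hanti (by omega)
  have hcard := T.content 1 le_rfl
  rw [card_pairs_eq_card_columns (fun i j => IsCell α (lamC k) i j ∧ T.entry i j = 1) (α 0)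
    (fun i i' j h h' => T.eq_of_entry_eq_s14 h.1 h'.1 (h.2.trans h'.2.symm))
    (fun i j h => h.1.2.trans_le (hα.1 (Nat.zero_le i)))] at hcard
  have hsub : ({3, 4, 5} : Finset ℕ) ⊆
      {j ∈ range (α 0) | ∃ i, IsCell α (lamC k) i j ∧ T.entry i j = 1} := by
    have key : ∀ j, 3 ≤ j → 0 < n j →
        j ∈ {j ∈ range (α 0) | ∃ i, IsCell α (lamC k) i j ∧ T.entry i j = 1} := by
      intro j hj hpos
      rw [mem_filter, mem_range]
      exact ⟨(hn 0 j).2 hpos, 0,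
        (isCell_lamC_iff hn (by omega) 0 j).2 ⟨hpos, by omega, by omega⟩,
        entry_eq_succ hα hn hk T hj hpos⟩
    intro j hj
    simp only [mem_insert, mem_singleton] at hj
    rcases hj with rfl | rfl | rfl <;> exact key _ (by omega) (by omega)
  have := card_le_card hsub
  rw [hcard, lamC1K, if_pos (by omega)] at this
  simp at this

/-- The values `m` occurring in column `j`. -/
def InCol {lam mu nu : ℕ → ℕ} (T : LRTableau lam mu nu) (j m : ℕ) : Prop :=
  ∃ i, IsCell lam mu i j ∧ T.entry i j = m

include hα hn hk in
lemma inCol_iff {j : ℕ} (hj : 3 ≤ j) (m : ℕ) : InCol T j m ↔ 1 ≤ m ∧ m ≤ n j := by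
  constructor
  · rintro ⟨i, hc, rfl⟩
    have hi := ((isCell_lamC_iff hn (by omega) i j).1 hc).1
    rw [entry_eq_succ hα hn hk T hj hi]
    omega
  · rintro ⟨h1, h2⟩
    refine ⟨m - 1, (isCell_lamC_iff hn (by omega) _ j).2 ⟨by omega, by omega, by omega⟩, ?_⟩
    rw [entry_eq_succ hα hn hk T hj (by omega)]
    omega

include hα hn hk in
lemma exists_inCol_two_iff (h2 : 1 ≤ n 2) :
    n 2 ≤ k + 1 ∧ ∃ r, 1 ≤ r ∧ r ≤ n 2 ∧ ∀ m, InCol T 2 m ↔ 1 ≤ m ∧ m ≤ n 2 ∧ m ≠ r := by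
  have hcell : ∀ i, IsCell α (lamC k) i 2 ↔ 1 ≤ i ∧ i < n 2 := fun i => by
    rw [isCell_lamC_iff hn (by omega)]; omega
  have hstep : ∀ i, 1 ≤ i → i + 1 < n 2 → T.entry i 2 < T.entry (i + 1) 2 := fun i h1 h2 =>
    T.col_strict i (i + 1) 2 (by omega) ((hcell i).2 (by omega)) ((hcell _).2 (by omega))
  have hge : ∀ i, 1 ≤ i → i < n 2 → i ≤ T.entry i 2 := by
    intro i h1
    induction i, h1 using Nat.le_induction with
    | base => exact fun h => T.pos 1 2 ((hcell 1).2 (by omega))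
    | succ i h1 ih =>
      intro h
      have := ih (by omega)
      have := hstep i h1 h
      omega
  have hle : ∀ i, 1 ≤ i → i < n 2 → T.entry i 2 ≤ i + 1 := fun i h1 h2 =>
    T.entry_le hα ((hcell i).2 ⟨h1, h2⟩)
  have hr : ∃ r, 1 ≤ r ∧ r ≤ n 2 ∧
      ∀ i, 1 ≤ i → i < n 2 → (i < r → T.entry i 2 = i) ∧ (r ≤ i → T.entry i 2 = i + 1) := by
    by_cases h : ∃ i, 1 ≤ i ∧ i < n 2 ∧ T.entry i 2 ≠ i
    · obtain ⟨hf1, hf2, hf3⟩ := Nat.find_spec h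
      refine ⟨Nat.find h, hf1, hf2.le, fun i h1 h2 => ⟨fun hi => ?_, fun hi => ?_⟩⟩
      · by_contra hne
        exact Nat.find_min h hi ⟨h1, h2, hne⟩
      · induction i, hi using Nat.le_induction with
        | base =>
          have := hge _ h1 h2
          have := hle _ h1 h2
          omega
        | succ i hi ih =>
          have := ih (by omega) (by omega)
          have := hstep i (by omega) h2
          have := hle _ h1 h2
          omega
    · push Not at h
      exact ⟨n 2, h2, le_rfl, fun i h1 h2 => ⟨fun _ => h i h1 h2, by omega⟩⟩
  refine ⟨?_, ?_⟩
  · by_contra! hgt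
    have := hge (n 2 - 1) (by omega) (by omega)
    have := entry_le_k hα T ((hcell (n 2 - 1)).2 (by omega))
    omega
  · obtain ⟨r, hr1, hr2, hr⟩ := hr
    refine ⟨r, hr1, hr2, fun m => ⟨?_, ?_⟩⟩
    · rintro ⟨i, hc, rfl⟩
      obtain ⟨h1, h2⟩ := (hcell i).1 hc
      have := hr i h1 h2
      omega
    · rintro ⟨h1, h2, hne⟩
      rcases lt_or_gt_of_ne hne with hlt | hgt
      · exact ⟨m, (hcell m).2 (by omega), (hr m h1 (by omega)).1 hlt⟩
      · exact ⟨m - 1, (hcell _).2 (by omega), by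
          rw [(hr (m - 1) (by omega) (by omega)).2 (by omega)]; omega⟩

include hα hn hk in
open Classical in
lemma content_columns {r : ℕ} (hr : ∀ m, InCol T 2 m ↔ 1 ≤ m ∧ m ≤ n 2 ∧ m ≠ r) {m : ℕ}
    (hm : 1 ≤ m) :
    (if InCol T 0 m then 1 else 0) + (if InCol T 1 m then 1 else 0) +
    (if m ≤ n 2 ∧ m ≠ r then 1 else 0) + (if m ≤ n 3 then 1 else 0) +
    (if m ≤ n 4 then 1 else 0) = if m < k then 2 else if m = k then 1 else 0 := by
  have h5 := colLen_five_eq_zero hα hn hk T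
  have h := T.content_eq_sum_five (fun i j hc => by
    by_contra! hj
    have h1 := ((isCell_lamC_iff hn (by omega) i j).1 hc).1
    have := colLen_antitone hn hj
    omega) m hm
  have e2 := hr m
  have e3 := inCol_iff hα hn hk T (le_refl 3) m
  have e4 := inCol_iff hα hn hk T (show 3 ≤ 4 by omega) m
  simp only [← InCol.eq_1] at h
  simp only [e2, e3, e4, hm, true_and] at h
  rw [h, lamC1K]
  split_ifs <;> omega

include hα hn hk in
open Classical in
lemma lattice_columns (h2 : n 2 ≤ k + 1) {r : ℕ}
    (hr : ∀ m, InCol T 2 m ↔ 1 ≤ m ∧ m ≤ n 2 ∧ m ≠ r) {l m : ℕ} (hl1 : 1 ≤ l)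
    (hl2 : l ≤ 2) (hm : 1 ≤ m) :
    (if l = 1 ∧ k < n 1 ∧ T.entry k 1 = m + 1 then 1 else 0) +
    (if m + 1 ≤ n 2 ∧ m + 1 ≠ r then 1 else 0) + (if m + 1 ≤ n 3 then 1 else 0) +
    (if m + 1 ≤ n 4 then 1 else 0) ≤
    (if l = 1 ∧ k < n 1 ∧ T.entry k 1 = m then 1 else 0) +
    (if m ≤ n 2 ∧ m ≠ r then 1 else 0) + (if m ≤ n 3 then 1 else 0) +
    (if m ≤ n 4 then 1 else 0) := by
  have h5 := colLen_five_eq_zero hα hn hk T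
  have hcell := isCell_lamC_iff hn (show 1 ≤ k by omega)
  have h := T.lattice_sum_five (fun i j hc => by
    by_contra! hj
    have h1 := ((hcell i j).1 hc).1
    have := colLen_antitone hn hj
    omega) k l m hm
  have hD0 : ∀ a, ¬ ∃ i', IsCell α (lamC k) i' 0 ∧ T.entry i' 0 = a ∧
      (i' < k ∨ (i' = k ∧ l ≤ 0)) := by
    rintro a ⟨i', hc, -, hb⟩
    have := (hcell i' 0).1 hc
    omega
  have hD1 : ∀ a, (∃ i', IsCell α (lamC k) i' 1 ∧ T.entry i' 1 = a ∧
      (i' < k ∨ (i' = k ∧ l ≤ 1))) ↔ l = 1 ∧ k < n 1 ∧ T.entry k 1 = a := by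
    intro a
    constructor
    · rintro ⟨i', hc, he, hb⟩
      have := (hcell i' 1).1 hc
      obtain rfl : i' = k := by omega
      exact ⟨by omega, this.1, he⟩
    · rintro ⟨rfl, h1, he⟩
      exact ⟨k, (hcell k 1).2 ⟨h1, by omega, by omega⟩, he, by omega⟩
  have hD : ∀ j a, 2 ≤ j → ((∃ i', IsCell α (lamC k) i' j ∧ T.entry i' j = a ∧
      (i' < k ∨ (i' = k ∧ l ≤ j))) ↔ InCol T j a) := by
    intro j a hj
    constructor
    · rintro ⟨i', hc, he, -⟩
      exact ⟨i', hc, he⟩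
    · rintro ⟨i', hc, he⟩
      have := ((hcell i' j).1 hc).1
      have := colLen_antitone hn hj
      exact ⟨i', hc, he, by omega⟩
  have e3 := inCol_iff hα hn hk T (le_refl 3)
  have e4 := inCol_iff hα hn hk T (show 3 ≤ 4 by omega)
  simp only [hD1, hD0, hD 2 _ le_rfl, hD 3 _ (show 2 ≤ 3 by omega),
    hD 4 _ (show 2 ≤ 4 by omega), hr, e3, e4, hm, true_and, if_false, zero_add,
    show 1 ≤ m + 1 by omega] at h
  exact h

include hα hn hk in
lemma exists_upperShape (h2 : 1 ≤ n 2) :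
    n 2 ≤ k + 1 ∧ ∃ r c b, (∀ m, InCol T 2 m ↔ 1 ≤ m ∧ m ≤ n 2 ∧ m ≠ r) ∧
      UpperShape (n 2) (n 3) (n 4) r c b := by
  classical
  obtain ⟨hk2, r, hr1, hr2, hr⟩ := exists_inCol_two_iff hα hn hk T h2
  refine ⟨hk2, r, ?_⟩
  have hanti := colLen_antitone hn
  have h32 : n 3 ≤ n 2 := hanti (by omega)
  have h43 : n 4 ≤ n 3 := hanti (by omega)
  have hc1 := content_columns hα hn hk T hr le_rfl
  have hc2 := content_columns hα hn hk T hr one_le_two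
  have hlat := lattice_columns hα hn hk T hk2 hr one_le_two le_rfl hr1
  have hcases : (n 4 = 0 ∧ n 3 < n 2 ∧ r = n 2) ∨ (n 4 = 1 ∧ 1 ≤ n 3 ∧ r = 1) ∨
      (n 4 = 0 ∧ 1 ≤ n 3 ∧ r = n 3) := by
    rcases Nat.eq_zero_or_pos (n 4) with h4 | h4
    · rcases hr2.eq_or_lt with rfl | hlt
      · by_cases h3 : n 3 < n 2 <;> omega
      · simp only [show ¬ (2 = 1) by omega, false_and, if_false, ne_eq, not_true_eq_false,
          and_false, if_pos (show r + 1 ≤ n 2 ∧ ¬ r + 1 = r by omega),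
          if_neg (show ¬ r ≤ n 4 by omega), if_neg (show ¬ r + 1 ≤ n 4 by omega)] at hlat
        split_ifs at hlat <;> omega
    · have hr1' : r = 1 := by
        by_contra hne
        rw [if_pos (show 1 ≤ n 2 ∧ 1 ≠ r by omega), if_pos (show 1 ≤ n 3 by omega),
          if_pos (show 1 ≤ n 4 by omega), if_pos (show 1 < k by omega)] at hc1
        omega
      have : ¬ 2 ≤ n 4 := by
        intro h
        rw [if_pos (show 2 ≤ n 2 ∧ 2 ≠ r by omega), if_pos (show 2 ≤ n 3 by omega),
          if_pos (show 2 ≤ n 4 by omega), if_pos (show 2 < k by omega)] at hc2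
        omega
      omega
  rcases hcases with h | h | h
  · exact ⟨n 3 + 1, n 2, hr, by unfold UpperShape; omega⟩
  · exact ⟨n 3 + 1, n 2 + 1, hr, by unfold UpperShape; omega⟩
  · exact ⟨n 3, n 2 + 1, hr, by unfold UpperShape; omega⟩

lemma UpperShape.multiplicity {n₂ n₃ n₄ r c b : ℕ} (h : UpperShape n₂ n₃ n₄ r c b)
    (h32 : n₃ ≤ n₂) (m : ℕ) (hm : 1 ≤ m) :
    (if m ≤ n₂ ∧ m ≠ r then 1 else 0) + (if m ≤ n₃ then 1 else 0) +
    (if m ≤ n₄ then 1 else 0) = if m < c then 2 else if m < b then 1 else 0 := by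
  unfold UpperShape at h
  rcases h with h | h | h <;> split_ifs <;> omega

include hα hn hk in
open Classical in
lemma content_lower {r c b m : ℕ} (hr : ∀ m, InCol T 2 m ↔ 1 ≤ m ∧ m ≤ n 2 ∧ m ≠ r)
    (hs : UpperShape (n 2) (n 3) (n 4) r c b) (hm : 1 ≤ m) :
    (if InCol T 0 m then 1 else 0) + (if InCol T 1 m then 1 else 0) +
    (if m < c then 2 else if m < b then 1 else 0) =
      if m < k then 2 else if m = k then 1 else 0 := by
  rw [← content_columns hα hn hk T hr hm,
    ← hs.multiplicity (colLen_antitone hn (by omega)) m hm]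
  ring

include hα hn hk in
/-- The lower part of column `1` consists of consecutive values. -/
lemma inCol_one_iff (h0 : k ≤ n 0) (h2 : n 2 ≤ k + 1) {r c b : ℕ}
    (hr : ∀ m, InCol T 2 m ↔ 1 ≤ m ∧ m ≤ n 2 ∧ m ≠ r)
    (hs : UpperShape (n 2) (n 3) (n 4) r c b) :
    (∀ m, InCol T 1 m ↔ b ≤ m ∧ m < b + (n 1 - k)) ∧ k ≤ b + (n 1 - k) ∧
      b + (n 1 - k) ≤ k + 1 := by
  classical
  have hanti := colLen_antitone hn
  have h10 : n 1 ≤ n 0 := hanti (by omega)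
  have h32 : n 3 ≤ n 2 := hanti (by omega)
  have hcell := isCell_lamC_iff hn (show 1 ≤ k by omega)
  have h5 := colLen_five_eq_zero hα hn hk T
  have hcont := fun m (hm : 1 ≤ m) => content_lower hα hn hk T hr hs hm
  have hb1 : 1 ≤ b := by unfold UpperShape at hs; omega
  have hfirst : k < n 1 → b ≤ T.entry k 1 := by
    intro hk1
    by_contra! hlt
    have c0 : IsCell α (lamC k) k 0 := (hcell k 0).2 (by omega)
    have c1 : IsCell α (lamC k) k 1 := (hcell k 1).2 (by omega)
    have hle := T.row_weak k 0 1 (by omega) c0 c1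
    have hu := T.pos _ _ c0
    have hcu := hcont _ hu
    have hcv := hcont _ (T.pos _ _ c1)
    rw [if_pos ⟨k, c0, rfl⟩] at hcu
    rw [if_pos (c := InCol T 1 _) ⟨k, c1, rfl⟩] at hcv
    have huc : c ≤ T.entry k 0 := by
      by_contra! h
      rw [if_pos h] at hcu
      split_ifs at hcu <;> omega
    have hne : T.entry k 0 ≠ T.entry k 1 := by
      intro he
      rw [if_pos ⟨k, c0, he⟩, if_neg (by omega), if_pos hlt] at hcv
      split_ifs at hcv <;> omega
    have hlat := lattice_columns hα hn hk T h2 hr le_rfl one_le_two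
      (show 1 ≤ T.entry k 1 - 1 by omega)
    have m1 := hs.multiplicity h32 (T.entry k 1 - 1) (by omega)
    have m2 := hs.multiplicity h32 (T.entry k 1 - 1 + 1) (by omega)
    rw [if_neg (show ¬ T.entry k 1 - 1 < c by omega), if_pos (show T.entry k 1 - 1 < b by omega)]
      at m1
    rw [if_neg (show ¬ T.entry k 1 - 1 + 1 < c by omega),
      if_pos (show T.entry k 1 - 1 + 1 < b by omega)] at m2
    rw [if_pos (⟨rfl, hk1, by omega⟩ : 1 = 1 ∧ k < n 1 ∧ T.entry k 1 = T.entry k 1 - 1 + 1),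
      if_neg (show ¬ (1 = 1 ∧ k < n 1 ∧ T.entry k 1 = T.entry k 1 - 1) by omega)] at hlat
    omega
  have hval : ∀ i, k + i < n 1 → T.entry (k + i) 1 = b + i := by
    intro i
    induction i using Nat.strong_induction_on with
    | _ i ih =>
      intro hi
      have ci : IsCell α (lamC k) (k + i) 1 := (hcell _ 1).2 (by omega)
      refine le_antisymm ?_ ?_
      · by_contra! hgt
        obtain ⟨i', j', hi', hc', he'⟩ := T.exists_pred hα
          (m := T.entry (k + i) 1 - 1) (by omega) ci (by omega)
        have hc'' := (hcell i' j').1 hc'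
        rcases lt_or_ge j' 2 with hj | hj
        · have c1 : IsCell α (lamC k) i' 1 := (hcell _ 1).2 (by omega)
          have := T.row_weak i' j' 1 (by omega) hc' c1
          have hv := ih (i' - k) (by omega) (by omega)
          rw [show k + (i' - k) = i' by omega] at hv
          omega
        · have hin : InCol T j' (T.entry (k + i) 1 - 1) := ⟨i', hc', he'⟩
          have hj5 : j' < 5 := by
            by_contra! h
            have := hanti h
            omega
          have h43 : n 4 ≤ n 3 := hanti (by omega)
          unfold UpperShape at hs
          rcases hj.eq_or_lt with rfl | hj
          · rw [hr] at hin
            omega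
          · rw [inCol_iff hα hn hk T hj] at hin
            have : n j' ≤ n 3 := hanti hj
            omega
      · rcases Nat.eq_zero_or_pos i with rfl | hpos
        · exact hfirst (by omega)
        · have := ih (i - 1) (by omega) (by omega)
          have := T.col_strict (k + (i - 1)) (k + i) 1 (by omega) ((hcell _ 1).2 (by omega)) ci
          omega
  have hiff : ∀ m, InCol T 1 m ↔ b ≤ m ∧ m < b + (n 1 - k) := by
    intro m
    constructor
    · rintro ⟨i, hc, rfl⟩
      have := (hcell i 1).1 hc
      have hv := hval (i - k) (by omega)
      rw [show k + (i - k) = i by omega] at hv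
      omega
    · rintro ⟨h1, h2⟩
      exact ⟨k + (m - b), (hcell _ 1).2 (by omega), by rw [hval _ (by omega)]; omega⟩
  refine ⟨hiff, ?_, ?_⟩
  · by_contra! h
    have := hcont (b + (n 1 - k)) (by omega)
    have hc : c ≤ b := by unfold UpperShape at hs; omega
    rw [if_neg (c := InCol T 1 _) (by rw [hiff]; omega)] at this
    split_ifs at this <;> omega
  · rcases Nat.eq_zero_or_pos (n 1 - k) with hq | hq
    · by_contra! h
      have := hcont (k + 1) (by omega)
      split_ifs at this <;> omega
    · have hv := hval (n 1 - k - 1) (by omega)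
      have := entry_le_k hα T ((hcell (k + (n 1 - k - 1)) 1).2 (by omega))
      omega

include hα hn hk in
lemma eq_of_inCol_two {T T' : LRTableau α (lamC k) (lamC1K k)} (h0 : k ≤ n 0) (h2 : n 2 ≤ k + 1)
    {r c b : ℕ} (hr : ∀ m, InCol T 2 m ↔ 1 ≤ m ∧ m ≤ n 2 ∧ m ≠ r)
    (hr' : ∀ m, InCol T' 2 m ↔ 1 ≤ m ∧ m ≤ n 2 ∧ m ≠ r)
    (hs : UpperShape (n 2) (n 3) (n 4) r c b) : T = T' := by
  classical
  have hcell := isCell_lamC_iff hn (show 1 ≤ k by omega)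
  have h1 := (inCol_one_iff hα hn hk T h0 h2 hr hs).1
  have h1' := (inCol_one_iff hα hn hk T' h0 h2 hr' hs).1
  have hin : ∀ j m, InCol T j m ↔ InCol T' j m := by
    intro j m
    by_cases hm : 1 ≤ m
    · match j with
      | 0 =>
        have e := content_lower hα hn hk T hr hs hm
        have e' := content_lower hα hn hk T' hr' hs hm
        simp only [h1, h1'] at e e'
        rw [← e'] at e
        have := Nat.add_right_cancel (Nat.add_right_cancel e)
        split_ifs at this <;> simp_all
      | 1 => rw [h1, h1']
      | 2 => rw [hr, hr']
      | j + 3 => rw [inCol_iff hα hn hk T (by omega), inCol_iff hα hn hk T' (by omega)]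
    · constructor <;>
      · rintro ⟨i, hc, rfl⟩
        exact absurd (LRTableau.pos _ i j hc) hm
  refine LRTableau.ext_entry fun i j hc => ?_
  obtain ⟨s, hs⟩ : ∃ s, ∀ i, IsCell α (lamC k) i j ↔ s ≤ i ∧ i < n j := by
    rcases Nat.lt_or_ge j 2 with h | h
    · exact ⟨k, fun i => by rw [hcell]; omega⟩
    · rcases h.eq_or_lt with rfl | h
      · exact ⟨1, fun i => by rw [hcell]; omega⟩
      · exact ⟨0, fun i => by rw [hcell]; omega⟩
  refine eq_of_strictMono_of_values (f := fun i => T.entry i j) (g := fun i => T'.entry i j)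
    (s := s) (e := n j) ?_ ?_ (fun m => ?_) i ((hs i).1 hc).1 ((hs i).1 hc).2
  · exact fun i i' h h' h'' => T.col_strict i i' j h' ((hs _).2 (by omega)) ((hs _).2 (by omega))
  · exact fun i i' h h' h'' => T'.col_strict i i' j h' ((hs _).2 (by omega)) ((hs _).2 (by omega))
  · simpa only [InCol, hs] using hin j m

include hα hn hk in
lemma lrCoeff_lamC_le_two (h0 : k ≤ n 0) (h2 : 1 ≤ n 2) :
    lrCoeff α (lamC k) (lamC1K k) ≤ 2 := by
  classical
  have hbool : Nat.card Bool = 2 := by simp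
  rw [lrCoeff, ← hbool]
  refine Nat.card_le_card_of_injective (fun T => decide (InCol T 2 (n 2) ∧ 1 ≤ n 2))
    fun T T' h => ?_
  obtain ⟨hk2, r, c, b, hr, hs⟩ := exists_upperShape hα hn hk T h2
  obtain ⟨-, r', c', b', hr', hs'⟩ := exists_upperShape hα hn hk T' h2
  have hrr : r = r' := by
    have := decide_eq_decide.1 h
    rw [hr, hr'] at this
    unfold UpperShape at hs hs'
    omega
  subst hrr
  exact eq_of_inCol_two hα hn hk h0 hk2 hr hr' hs

end ContentC1K

/-- The number of entries `m` among the columns of lengths `a₂, a₃, a₄` filled by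
`1, 2, 3, …`, the sequence `z, w + 1, w + 2, …` of length `f` and the sequence
`x, y + 1, y + 2, …` of length `g`. -/
def entryCount (a₂ a₃ a₄ x y z w f g m : ℕ) : ℕ :=
  (if (m = x ∧ 1 ≤ g) ∨ (y + 1 ≤ m ∧ m < y + g) then 1 else 0) +
  (if (m = z ∧ 1 ≤ f) ∨ (w + 1 ≤ m ∧ m < w + f) then 1 else 0) +
  (if m ≤ a₂ then 1 else 0) + (if m ≤ a₃ then 1 else 0) + (if m ≤ a₄ then 1 else 0)

/-- A numerical criterion for the existence of an LR tableau of shape `α / (2^k)` whose lower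
columns consist of a first entry followed by consecutive values. -/
lemma nonempty_lrTableau_of_entryCount {k : ℕ} {α n nu : ℕ → ℕ}
    (hn : ∀ i j, j < α i ↔ i < n j) (h5 : n 5 = 0) (h2 : n 2 ≤ k) {x y z w : ℕ}
    (hx : 1 ≤ x) (hxy : x ≤ y) (hzw : z ≤ w) (hxz : x ≤ z) (hyw : y ≤ w)
    (hcont : ∀ m, 1 ≤ m →
      entryCount (n 2) (n 3) (n 4) x y z w (n 1 - k) (n 0 - k) m = nu (m - 1))
    (hlat : ∀ f g m, 1 ≤ m → f ≤ n 1 - k → g ≤ n 0 - k → g ≤ f ∨ f = n 1 - k → f ≤ g + 1 →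
      entryCount (n 2) (n 3) (n 4) x y z w f g (m + 1) ≤
        entryCount (n 2) (n 3) (n 4) x y z w f g m) :
    Nonempty (LRTableau α (lamC1 k) nu) := by
  classical
  have hanti := colLen_antitone hn
  have h10 : n 1 ≤ n 0 := hanti (by omega)
  have hcell := isCell_lamC1_iff (k := k) hn
  have hrow : ∀ i j, IsCell α (lamC1 k) i j → (j < 2 ↔ k ≤ i) := by
    intro i j hc
    have hc' := (hcell i j).1 hc
    refine ⟨hc'.2, fun hi => ?_⟩
    by_contra! hj
    have := hanti hj
    omega
  let E : ℕ → ℕ → ℕ := fun i j =>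
    if 2 ≤ j then i + 1 else if j = 1 then (if i = k then z else w + (i - k))
      else (if i = k then x else y + (i - k))
  let F : ℕ → ℕ → ℕ := fun i j => if IsCell α (lamC1 k) i j then E i j else 0
  have hF : ∀ {i j}, IsCell α (lamC1 k) i j → F i j = E i j := fun hc => if_pos hc
  have hcol : ∀ i i' j, i < i' → IsCell α (lamC1 k) i j → IsCell α (lamC1 k) i' j →
      F i j < F i' j := by
    intro i i' j hi hc hc'
    have := (hcell i j).1 hc
    rw [hF hc, hF hc']
    dsimp only [E]
    split_ifs <;> omega
  have huniq : ∀ i i' j, IsCell α (lamC1 k) i j → IsCell α (lamC1 k) i' j → F i j = F i' j →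
      i = i' := by
    intro i i' j hc hc' he
    rcases lt_trichotomy i i' with hlt | rfl | hlt
    · exact absurd (hcol i i' j hlt hc hc') (by omega)
    · rfl
    · exact absurd (hcol i' i j hlt hc' hc) (by omega)
  have hj5 : ∀ i j, IsCell α (lamC1 k) i j → j < 5 := by
    intro i j hc
    by_contra! hj
    have := hanti hj
    have := ((hcell i j).1 hc).1
    omega
  have hupper : ∀ j e m, 2 ≤ j → 1 ≤ m →
      ((∃ i, IsCell α (lamC1 k) i j ∧ F i j = m ∧ i < e) ↔ m ≤ min (n j) e) := by
    intro j e m hj hm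
    constructor
    · rintro ⟨i, hc, he, hi⟩
      rw [hF hc] at he
      have := ((hcell i j).1 hc).1
      simp only [E, if_pos hj] at he
      omega
    · intro h
      have hc : IsCell α (lamC1 k) (m - 1) j := (hcell _ j).2 (by omega)
      refine ⟨m - 1, hc, ?_, by omega⟩
      rw [hF hc]
      simp only [E, if_pos hj]
      omega
  have hone : ∀ e m, ((∃ i, IsCell α (lamC1 k) i 1 ∧ F i 1 = m ∧ i < e) ↔
      (m = z ∧ 1 ≤ min (n 1) e - k) ∨ (w + 1 ≤ m ∧ m < w + (min (n 1) e - k))) := by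
    intro e m
    constructor
    · rintro ⟨i, hc, he, hi⟩
      rw [hF hc] at he
      have := (hcell i 1).1 hc
      simp only [E, show ¬ 2 ≤ 1 by omega, if_false, if_true] at he
      split_ifs at he <;> omega
    · rintro (⟨rfl, h⟩ | ⟨h, h'⟩)
      · have hc : IsCell α (lamC1 k) k 1 := (hcell _ 1).2 (by omega)
        exact ⟨k, hc, by rw [hF hc]; simp [E], by omega⟩
      · have hc : IsCell α (lamC1 k) (k + (m - w)) 1 := (hcell _ 1).2 (by omega)
        refine ⟨k + (m - w), hc, ?_, by omega⟩
        rw [hF hc]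
        simp only [E, show ¬ 2 ≤ 1 by omega, if_false, if_true]
        split_ifs <;> omega
  have hzero : ∀ e m, ((∃ i, IsCell α (lamC1 k) i 0 ∧ F i 0 = m ∧ i < e) ↔
      (m = x ∧ 1 ≤ min (n 0) e - k) ∨ (y + 1 ≤ m ∧ m < y + (min (n 0) e - k))) := by
    intro e m
    constructor
    · rintro ⟨i, hc, he, hi⟩
      rw [hF hc] at he
      have := (hcell i 0).1 hc
      simp only [E, show ¬ 2 ≤ 0 by omega, show ¬ 0 = 1 by omega, if_false] at he
      split_ifs at he <;> omega
    · rintro (⟨rfl, h⟩ | ⟨h, h'⟩)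
      · have hc : IsCell α (lamC1 k) k 0 := (hcell _ 0).2 (by omega)
        exact ⟨k, hc, by rw [hF hc]; simp [E], by omega⟩
      · have hc : IsCell α (lamC1 k) (k + (m - y)) 0 := (hcell _ 0).2 (by omega)
        refine ⟨k + (m - y), hc, ?_, by omega⟩
        rw [hF hc]
        simp only [E, show ¬ 2 ≤ 0 by omega, show ¬ 0 = 1 by omega, if_false]
        split_ifs <;> omega
  /- The number of entries `m` among the first `e j` rows of each column `j`. -/
  have hcount : ∀ (e : ℕ → ℕ) m, 1 ≤ m →
      Nat.card {p : ℕ × ℕ // IsCell α (lamC1 k) p.1 p.2 ∧ F p.1 p.2 = m ∧ p.1 < e p.2} =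
      entryCount (min (n 2) (e 2)) (min (n 3) (e 3)) (min (n 4) (e 4)) x y z w
        (min (n 1) (e 1) - k) (min (n 0) (e 0) - k) m := by
    intro e m hm
    rw [card_pairs_eq_sum_five (fun i j => IsCell α (lamC1 k) i j ∧ F i j = m ∧ i < e j)
      (fun i i' j h h' => huniq i i' j h.1 h'.1 (h.2.1.trans h'.2.1.symm))
      (fun i j h => hj5 i j h.1)]
    simp only [hzero, hone, hupper 2 _ _ le_rfl hm, hupper 3 _ _ (show 2 ≤ 3 by omega) hm,
      hupper 4 _ _ (show 2 ≤ 4 by omega) hm]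
    rfl
  refine ⟨⟨F, ?_, fun i j hc => if_neg hc, ?_, hcol, ?_, ?_⟩⟩
  · intro i j hc
    rw [hF hc]
    dsimp only [E]
    split_ifs <;> omega
  · intro i j j' hj hc hc'
    have h1 := hrow i j hc
    have h2 := hrow i j' hc'
    rw [hF hc, hF hc']
    dsimp only [E]
    split_ifs <;> omega
  · intro m hm
    rw [← hcont m hm]
    have := hcount n m hm
    simp only [min_self] at this
    rw [← this]
    refine Nat.card_congr (Equiv.subtypeEquivRight fun p => ?_)
    have := fun h => ((hcell p.1 p.2).1 h).1
    tauto
  · intro i j m hm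
    have hpre : ∀ a, Nat.card {p : ℕ × ℕ // IsCell α (lamC1 k) p.1 p.2 ∧ F p.1 p.2 = a ∧
        (p.1 < i ∨ (p.1 = i ∧ j ≤ p.2))} = Nat.card {p : ℕ × ℕ // IsCell α (lamC1 k) p.1 p.2 ∧
        F p.1 p.2 = a ∧ p.1 < if j ≤ p.2 then i + 1 else i} := by
      intro a
      refine Nat.card_congr (Equiv.subtypeEquivRight fun p => ?_)
      refine and_congr_right fun _ => and_congr_right fun _ => ?_
      split_ifs <;> omega
    rw [hpre, hpre, hcount (fun j' => if j ≤ j' then i + 1 else i) _ (by omega),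
      hcount (fun j' => if j ≤ j' then i + 1 else i) _ hm]
    have h3 : n 3 ≤ n 2 := hanti (by omega)
    have h4 : n 4 ≤ n 3 := hanti (by omega)
    rcases lt_or_ge i k with hi | hi
    · have hz : ∀ j' l, min (n j') (if j ≤ l then i + 1 else i) - k = 0 := by
        intro j' l
        split_ifs <;> omega
      simp only [hz, entryCount]
      gcongr ?_ + ?_ + ?_ + ?_ + ?_ <;> split_ifs <;> omega
    · have hm : ∀ j' l, n j' ≤ k → min (n j') (if j ≤ l then i + 1 else i) = n j' := by
        intro j' l h
        split_ifs <;> omega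
      rw [hm 2 _ h2, hm 3 _ (by omega), hm 4 _ (by omega)]
      refine hlat _ _ _ (by omega) ?_ ?_ ?_ ?_ <;> split_ifs <;> omega

lemma entryCount_consecutive (a₂ a₃ a₄ f g : ℕ) {m : ℕ} (hm : 1 ≤ m) :
    entryCount a₂ a₃ a₄ (a₃ + 1) (a₃ + 1) (a₂ + 1) (a₂ + 1) f g m =
      (if m ≤ a₂ + f then 1 else 0) + (if m ≤ a₃ + g then 1 else 0) +
      (if m ≤ a₄ then 1 else 0) + if m ≤ 0 then 1 else 0 := by
  have h1 : (if (m = a₂ + 1 ∧ 1 ≤ f) ∨ (a₂ + 1 + 1 ≤ m ∧ m < a₂ + 1 + f) then 1 else 0) +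
      (if m ≤ a₂ then 1 else 0) = if m ≤ a₂ + f then 1 else 0 := by
    split_ifs <;> omega
  have h2 : (if (m = a₃ + 1 ∧ 1 ≤ g) ∨ (a₃ + 1 + 1 ≤ m ∧ m < a₃ + 1 + g) then 1 else 0) +
      (if m ≤ a₃ then 1 else 0) = if m ≤ a₃ + g then 1 else 0 := by
    split_ifs <;> omega
  rw [entryCount, ← h1, ← h2, if_neg (show ¬ m ≤ 0 by omega)]
  ring

lemma entryCount_one_left {a₃ m : ℕ} (a₂ a₄ f g : ℕ) (h3 : 1 ≤ a₃) (hm : 1 ≤ m) :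
    entryCount a₂ a₃ a₄ 1 a₃ (a₂ + 1) (a₂ + 1) f g m =
      (if m ≤ a₂ + f then 1 else 0) + (if m ≤ a₃ + (g - 1) then 1 else 0) +
      (if m ≤ a₄ then 1 else 0) + if m ≤ min 1 g then 1 else 0 := by
  have h1 : (if (m = a₂ + 1 ∧ 1 ≤ f) ∨ (a₂ + 1 + 1 ≤ m ∧ m < a₂ + 1 + f) then 1 else 0) +
      (if m ≤ a₂ then 1 else 0) = if m ≤ a₂ + f then 1 else 0 := by
    split_ifs <;> omega
  have h2 : (if (m = 1 ∧ 1 ≤ g) ∨ (a₃ + 1 ≤ m ∧ m < a₃ + g) then 1 else 0) +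
      (if m ≤ a₃ then 1 else 0) =
      (if m ≤ a₃ + (g - 1) then 1 else 0) + if m ≤ min 1 g then 1 else 0 := by
    split_ifs <;> omega
  rw [entryCount, ← h1]
  linarith

lemma entryCount_crossed {a₂ a₃ f g m : ℕ} (a₄ : ℕ) (h32 : a₃ < a₂) (hfg : 2 ≤ g → 1 ≤ f)
    (hm : 1 ≤ m) :
    entryCount a₂ a₃ a₄ 1 (a₃ + 1) (a₃ + 1) a₂ f g m =
      (if m ≤ a₂ + (f - 1) then 1 else 0) + (if m ≤ a₃ + (min 1 f + (g - 1)) then 1 else 0) +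
      (if m ≤ a₄ then 1 else 0) + if m ≤ min 1 g then 1 else 0 := by
  have h1 : (if (m = a₃ + 1 ∧ 1 ≤ f) ∨ (a₂ + 1 ≤ m ∧ m < a₂ + f) then 1 else 0) +
      (if m ≤ a₂ then 1 else 0) =
      (if m = a₃ + 1 ∧ 1 ≤ f then 1 else 0) + if m ≤ a₂ + (f - 1) then 1 else 0 := by
    split_ifs <;> omega
  have h2 : (if (m = 1 ∧ 1 ≤ g) ∨ (a₃ + 1 + 1 ≤ m ∧ m < a₃ + 1 + g) then 1 else 0) +
      ((if m = a₃ + 1 ∧ 1 ≤ f then 1 else 0) + if m ≤ a₃ then 1 else 0) =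
      (if m ≤ a₃ + (min 1 f + (g - 1)) then 1 else 0) + if m ≤ min 1 g then 1 else 0 := by
    split_ifs <;> omega
  rw [entryCount]
  linarith

/-- If entries are counted by initial segments of `1, 2, 3, …`, the lattice condition holds. -/
lemma entryCount_succ_le {a₂ a₃ a₄ x y z w f g m : ℕ} (s₁ s₂ s₃ s₄ : ℕ) (hm : 1 ≤ m)
    (h : ∀ m, 1 ≤ m → entryCount a₂ a₃ a₄ x y z w f g m =
      (if m ≤ s₁ then 1 else 0) + (if m ≤ s₂ then 1 else 0) +
      (if m ≤ s₃ then 1 else 0) + if m ≤ s₄ then 1 else 0) :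
    entryCount a₂ a₃ a₄ x y z w f g (m + 1) ≤ entryCount a₂ a₃ a₄ x y z w f g m := by
  rw [h _ hm, h _ (by omega)]
  gcongr ?_ + ?_ + ?_ + ?_ <;> split_ifs <;> omega

lemma initialSegments_eq_lamCK {k s₁ s₂ s₃ s₄ m : ℕ} (hk : 3 ≤ k) (hm : 1 ≤ m)
    (h1 : s₁ = k ∨ s₁ + 1 = k) (h12 : s₁ + s₂ + 1 = 2 * k) (h34 : s₃ + s₄ = 1) :
    (if m ≤ s₁ then 1 else 0) + (if m ≤ s₂ then 1 else 0) +
    (if m ≤ s₃ then 1 else 0) + (if m ≤ s₄ then 1 else 0) = lamCK k (m - 1) := by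
  unfold lamCK
  split_ifs <;> omega

/-- The existence of an LR tableau of shape `α / (2^k)` and content `(3, 2^(k-2), 1)` in terms of
the column lengths of `α`. -/
lemma nonempty_lrTableau_lamC1 {k : ℕ} {α n : ℕ → ℕ} (hn : ∀ i j, j < α i ↔ i < n j)
    (hk : 3 ≤ k) (h1 : k ≤ n 1) (h5 : n 5 = 0) (h2 : 1 ≤ n 2)
    (hsize : n 0 + n 1 + n 2 + n 3 + n 4 = 4 * k) {r c b : ℕ}
    (hs : UpperShape (n 2) (n 3) (n 4) r c b) (hb : k ≤ b + (n 1 - k))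
    (hb' : b + (n 1 - k) ≤ k + 1)
    (hne1 : ¬ (n 0 = 2 * k ∧ n 1 = k ∧ n 2 = k ∧ n 3 = 0))
    (hne2 : ¬ (n 2 = k ∧ n 3 = k)) :
    Nonempty (LRTableau α (lamC1 k) (lamCK k)) := by
  have hanti := colLen_antitone hn
  have h10 : n 1 ≤ n 0 := hanti (by omega)
  have h21 : n 2 ≤ n 1 := hanti (by omega)
  have h32 : n 3 ≤ n 2 := hanti (by omega)
  have h2k : n 2 ≤ k := by unfold UpperShape at hs; omega
  have h3k : n 3 < k := by unfold UpperShape at hs; omega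
  by_cases h4 : n 4 = 0
  · by_cases h3 : 1 ≤ n 3 ∧ n 2 + (n 1 - k) ≤ k
    · have hb1 : k ≤ n 2 + 1 + (n 1 - k) := by unfold UpperShape at hs; omega
      refine nonempty_lrTableau_of_entryCount (x := 1) (y := n 3) (z := n 2 + 1) (w := n 2 + 1)
        hn h5 h2k (by omega) (by omega) (by omega) (by omega) (by omega)
        (fun m hm => ?_) (fun f g m hm _ _ _ _ => ?_)
      · rw [entryCount_one_left _ _ _ _ h3.1 hm]
        exact initialSegments_eq_lamCK hk hm (by omega) (by omega) (by omega)
      · exact entryCount_succ_le _ _ _ _ hm fun m hm => entryCount_one_left _ _ _ _ h3.1 hm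
    · have hlt : n 3 < n 2 ∧ (n 2 + (n 1 - k) = k ∨ n 2 + (n 1 - k) = k + 1) ∧ k < n 1 := by
        unfold UpperShape at hs; omega
      refine nonempty_lrTableau_of_entryCount (x := 1) (y := n 3 + 1) (z := n 3 + 1) (w := n 2)
        hn h5 h2k (by omega) (by omega) (by omega) (by omega) (by omega)
        (fun m hm => ?_) (fun f g m hm _ _ _ _ => ?_)
      · rw [entryCount_crossed _ hlt.1 (by omega) hm]
        exact initialSegments_eq_lamCK hk hm (by omega) (by omega) (by omega)
      · exact entryCount_succ_le _ _ _ _ hm fun m hm =>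
          entryCount_crossed _ hlt.1 (by omega) hm
  · have h4' : n 4 = 1 ∧ 1 ≤ n 3 ∧ b = n 2 + 1 := by unfold UpperShape at hs; omega
    refine nonempty_lrTableau_of_entryCount (x := n 3 + 1) (y := n 3 + 1) (z := n 2 + 1)
      (w := n 2 + 1) hn h5 h2k (by omega) (by omega) (by omega) (by omega) (by omega)
      (fun m hm => ?_) (fun f g m hm _ _ _ _ => ?_)
    · rw [entryCount_consecutive _ _ _ _ _ hm]
      exact initialSegments_eq_lamCK hk hm (by omega) (by omega) (by omega)
    · exact entryCount_succ_le _ _ _ _ hm fun m hm => entryCount_consecutive _ _ _ _ _ hm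

/-- for `λ' = (3, 2^(k-1))` with `k ≥ 3` and any partition `α'` of
`4k = 2|λ'| - 2` containing `λ'` and different from `(3^k, 1^k)` and `(4^k)`, we have
`2 * c^{α'}_{λ'_(1), λ'_(k)} ≥ c^{α'}_{λ', λ'_(1,k)}`. -/
theorem conj_lr_inequality (k : ℕ) (hk : 3 ≤ k) (α : ℕ → ℕ) (hα : IsPartition α)
    (hsize : ∑ᶠ i, α i = 4 * k) (hcont : ∀ i, lamC k i ≤ α i)
    (hne1 : α ≠ fun i => if i < k then 3 else if i < 2 * k then 1 else 0)
    (hne2 : α ≠ fun i => if i < k then 4 else 0) :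
    lrCoeff α (lamC k) (lamC1K k) ≤ 2 * lrCoeff α (lamC1 k) (lamCK k) := by
  obtain ⟨n, hn⟩ := hα.exists_colLen
  rcases isEmpty_or_nonempty (LRTableau α (lamC k) (lamC1K k)) with hT | ⟨⟨T⟩⟩
  · simp [lrCoeff]
  have h0 : k ≤ n 0 := by
    have h := (hn (k - 1) 0).1 (lt_of_lt_of_le (by unfold lamC; split_ifs <;> omega)
      (hcont (k - 1)))
    omega
  have h1 : k ≤ n 1 := by
    have h := (hn (k - 1) 1).1 (lt_of_lt_of_le (by unfold lamC; split_ifs <;> omega)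
      (hcont (k - 1)))
    omega
  have h2 : 1 ≤ n 2 := (hn 0 2).1 (lt_of_lt_of_le (by simp [lamC]) (hcont 0))
  have h5 := colLen_five_eq_zero hα hn hk T
  have hsum : n 0 + n 1 + n 2 + n 3 + n 4 = 4 * k := by
    rw [← finsum_eq_sum_colLen hn h5, hsize]
  have h43 : n 4 ≤ n 3 := colLen_antitone hn (by omega)
  have hα5 : ∀ i, ¬ 5 < α i := fun i h => by
    have := (hn i 5).1 h
    omega
  obtain ⟨hk2, r, c, b, hr, hs⟩ := exists_upperShape hα hn hk T h2
  obtain ⟨-, hb, hb'⟩ := inCol_one_iff hα hn hk T h0 hk2 hr hs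
  have hne : Nonempty (LRTableau α (lamC1 k) (lamCK k)) := by
    refine nonempty_lrTableau_lamC1 hn hk h1 h5 h2 hsum hs hb hb' ?_ ?_
    · rintro ⟨e0, e1, e2, e3⟩
      refine hne1 (funext fun i => ?_)
      have g0 := hn i 0
      have g1 := hn i 1
      have g2 := hn i 2
      have g3 := hn i 3
      split_ifs <;> omega
    · rintro ⟨e2, e3⟩
      refine hne2 (funext fun i => ?_)
      have g0 := hn i 0
      have g3 := hn i 3
      have g4 := hn i 4
      have h21 : n 2 ≤ n 1 := colLen_antitone hn (by omega)
      have h10 : n 1 ≤ n 0 := colLen_antitone hn (by omega)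
      split_ifs <;> omega
  have hpos : 0 < lrCoeff α (lamC1 k) (lamCK k) :=
    Nat.card_pos_iff.2 ⟨hne, LRTableau.finite hα⟩
  have hle := lrCoeff_lamC_le_two hα hn hk h0 h2
  omega

end
end

section
/- Let k ≥ 3, let λ' = (3, 2^{k−1}), and set λ'_{(1)} = (2^k), λ'_{(k)} = (3, 2^{k−2}, 1), λ'_{(1,k)} = (2^{k−1}, 1), λ'_{(k,↑)} = (3, 2^{k−3}, 1, 1), λ'_{(k,←)} = (3, 2^{k−2}). Let β'_1 = (3^k, 1^k) and β'_2 = (4^k). Then for each i ∈ {1, 2}, the Littlewood–Richardson coefficients are: c^{β'_i}_{λ'_{(1)}, λ'_{(k)}} = 0, c^{β'_i}_{λ'_{(k)}, λ'_{(k)}} = 1, c^{β'_i}_{λ'_{(1)}, λ'_{(1)}} = 1, c^{β'_i}_{λ', λ'_{(1,k)}} = 1, c^{β'_i}_{λ', λ'_{(k,↑)}} = 0, and c^{β'_i}_{λ', λ'_{(k,←)}} = 0. -/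
noncomputable section

/-- `λ'_(k,↑) = (3, 2^(k-3), 1, 1)` for `λ' = (3, 2^(k-1))`. -/
def lamCUp (k : ℕ) : ℕ → ℕ :=
  fun i => if i = 0 then 3 else if i < k - 2 then 2 else if i < k then 1 else 0

/-- `λ'_(k,←) = (3, 2^(k-2))` for `λ' = (3, 2^(k-1))`. -/
def lamCLeft (k : ℕ) : ℕ → ℕ := fun i => if i = 0 then 3 else if i < k - 1 then 2 else 0

/-- The cells `(i, j)` with `a j ≤ i < b j` and `j < J`. -/
def columnCells (J : ℕ) (a b : ℕ → ℕ) : Finset (ℕ × ℕ) :=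
  (Finset.range J).biUnion fun j => (Finset.Ico (a j) (b j)).image fun i => (i, j)

lemma mem_columnCells {J : ℕ} {a b : ℕ → ℕ} (hJ : ∀ j, J ≤ j → b j ≤ a j) (p : ℕ × ℕ) :
    p ∈ columnCells J a b ↔ a p.2 ≤ p.1 ∧ p.1 < b p.2 := by
  obtain ⟨i, j⟩ := p
  simp only [columnCells, Finset.mem_biUnion, Finset.mem_range, Finset.mem_image,
    Finset.mem_Ico, Prod.mk.injEq]
  constructor
  · rintro ⟨_, _, _, h, rfl, rfl⟩
    exact h
  · intro h
    refine ⟨j, ?_, i, h, rfl, rfl⟩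
    by_contra hj
    have := hJ j (by omega)
    omega

/-- The filling of the cells `a j ≤ i < b j` whose columns read `1, 2, 3, …` downwards. -/
def columnFilling (a b : ℕ → ℕ) (i j : ℕ) : ℕ :=
  if a j ≤ i ∧ i < b j then i + 1 - a j else 0

lemma card_columnFilling_eq {J : ℕ} {a b : ℕ → ℕ} (hJ : ∀ j, J ≤ j → b j ≤ a j) {m : ℕ}
    (hm : 1 ≤ m) :
    ((columnCells J a b).filter fun p => columnFilling a b p.1 p.2 = m).card =
      ((Finset.range J).filter fun j => a j + m ≤ b j).card := by
  symm
  refine Finset.card_bij (fun j _ => (a j + m - 1, j)) ?_ ?_ ?_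
  · intro j hj
    simp only [Finset.mem_filter, Finset.mem_range] at hj
    simp only [Finset.mem_filter, mem_columnCells hJ]
    simp only [columnFilling]
    rw [if_pos (by omega)]
    omega
  · intro j _ j' _ h
    exact (Prod.mk.inj h).2
  · rintro ⟨i, j⟩ h
    simp only [Finset.mem_filter, mem_columnCells hJ] at h
    simp only [columnFilling] at h
    rw [if_pos h.1] at h
    refine ⟨j, ?_, ?_⟩
    · simp only [Finset.mem_filter, Finset.mem_range]
      refine ⟨?_, by omega⟩
      by_contra hj
      have := hJ j (by omega)
      omega
    · simp only [Prod.mk.injEq, and_true]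
      omega

/-- The columnwise filling of a skew shape is a Littlewood–Richardson tableau whose content is
conjugate to the multiset of column lengths. -/
def columnTableau {lam mu nu : ℕ → ℕ} {J : ℕ} {a b : ℕ → ℕ}
    (hcell : ∀ i j, IsCell lam mu i j ↔ a j ≤ i ∧ i < b j)
    (hJ : ∀ j, J ≤ j → b j ≤ a j) (ha : Antitone a)
    (hnu : ∀ m, 1 ≤ m → ((Finset.range J).filter fun j => a j + m ≤ b j).card = nu (m - 1)) :
    LRTableau lam mu nu where
  entry := columnFilling a b
  pos i j h := by
    rw [hcell] at h
    rw [columnFilling, if_pos h]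
    omega
  zero i j h := by
    rw [hcell] at h
    rw [columnFilling, if_neg h]
  row_weak i j j' hj h h' := by
    rw [hcell] at h h'
    rw [columnFilling, columnFilling, if_pos h, if_pos h']
    have := ha hj
    omega
  col_strict i i' j hi h h' := by
    rw [hcell] at h h'
    rw [columnFilling, columnFilling, if_pos h, if_pos h']
    omega
  content m hm := by
    rw [← hnu m hm, ← card_columnFilling_eq hJ hm]
    refine Nat.subtype_card _ fun p => ?_
    rw [Finset.mem_filter, mem_columnCells hJ, hcell]
  lattice i j m hm := by
    rw [Nat.subtype_card ((columnCells J a b).filter fun p => columnFilling a b p.1 p.2 = m + 1 ∧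
        (p.1 < i ∨ (p.1 = i ∧ j ≤ p.2)))
        fun p => by rw [Finset.mem_filter, mem_columnCells hJ, hcell],
      Nat.subtype_card ((columnCells J a b).filter fun p => columnFilling a b p.1 p.2 = m ∧
        (p.1 < i ∨ (p.1 = i ∧ j ≤ p.2)))
        fun p => by rw [Finset.mem_filter, mem_columnCells hJ, hcell]]
    refine Finset.card_le_card_of_injOn (fun p => (p.1 - 1, p.2)) ?_ ?_
    · rintro ⟨r, c⟩ h
      simp only [Finset.coe_filter, Set.mem_ofPred_eq, mem_columnCells hJ] at h ⊢
      simp only [columnFilling] at h ⊢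
      obtain ⟨h1, h2, h3⟩ := h
      rw [if_pos h1] at h2
      rw [if_pos (by omega)]
      omega
    · rintro ⟨r, c⟩ h ⟨r', c'⟩ h' heq
      simp only [Finset.coe_filter, Set.mem_ofPred_eq, mem_columnCells hJ] at h h'
      simp only [columnFilling] at h h'
      rw [if_pos h.1] at h
      rw [if_pos h'.1] at h'
      obtain ⟨h1, h2⟩ := Prod.mk.inj heq
      simp only at h1 h2
      subst h2
      rw [Prod.mk.injEq]
      omega

lemma LRTableau.columnFilling_le {lam mu nu : ℕ → ℕ} {a b : ℕ → ℕ}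
    (hcell : ∀ i j, IsCell lam mu i j ↔ a j ≤ i ∧ i < b j)
    (T : LRTableau lam mu nu) (i j : ℕ) : columnFilling a b i j ≤ T.entry i j := by
  by_cases h : a j ≤ i ∧ i < b j
  · rw [columnFilling, if_pos h]
    obtain ⟨h1, h2⟩ := h
    induction i, h1 using Nat.le_induction with
    | base =>
      have := T.pos (a j) j ((hcell _ _).2 ⟨le_rfl, h2⟩)
      omega
    | succ i hi ih =>
      have := ih (by omega)
      have := T.col_strict i (i + 1) j (by omega) ((hcell _ _).2 ⟨hi, by omega⟩)
        ((hcell _ _).2 ⟨by omega, h2⟩)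
      omega
  · rw [columnFilling, if_neg h]
    exact Nat.zero_le _

lemma LRTableau.ext_entry_s15 {lam mu nu : ℕ → ℕ} {T T' : LRTableau lam mu nu}
    (h : T.entry = T'.entry) : T = T' := by
  cases T
  cases T'
  cases h
  rfl

/-- Entries dominate the columnwise filling, and the content fixes their sum. -/
lemma LRTableau.entry_eq_columnFilling {lam mu nu : ℕ → ℕ} {J : ℕ} {a b : ℕ → ℕ}
    (hcell : ∀ i j, IsCell lam mu i j ↔ a j ≤ i ∧ i < b j)
    (hJ : ∀ j, J ≤ j → b j ≤ a j)
    (hnu : ∀ m, 1 ≤ m → ((Finset.range J).filter fun j => a j + m ≤ b j).card = nu (m - 1))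
    (T : LRTableau lam mu nu) : T.entry = columnFilling a b := by
  have hmap : (columnCells J a b).val.map (fun p => columnFilling a b p.1 p.2) =
      (columnCells J a b).val.map (fun p => T.entry p.1 p.2) := by
    ext m
    rw [Multiset.count_map, Multiset.count_map]
    change ((columnCells J a b).filter fun p => m = columnFilling a b p.1 p.2).card =
      ((columnCells J a b).filter fun p => m = T.entry p.1 p.2).card
    simp only [eq_comm (a := m)]
    rcases Nat.eq_zero_or_pos m with rfl | hm
    · rw [Finset.filter_false_of_mem, Finset.filter_false_of_mem]
      · intro p hp
        have := T.pos p.1 p.2 ((hcell _ _).2 ((mem_columnCells hJ p).1 hp))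
        omega
      · intro p hp
        rw [mem_columnCells hJ] at hp
        rw [columnFilling, if_pos hp]
        omega
    · rw [card_columnFilling_eq hJ hm, hnu m hm, ← T.content m hm]
      refine Nat.subtype_card _ fun p => ?_
      rw [Finset.mem_filter, mem_columnCells hJ, hcell]
  have hsum : ∑ p ∈ columnCells J a b, columnFilling a b p.1 p.2 =
      ∑ p ∈ columnCells J a b, T.entry p.1 p.2 := congrArg Multiset.sum hmap
  have heq := (Finset.sum_eq_sum_iff_of_le fun p _ => T.columnFilling_le hcell p.1 p.2).1 hsum
  funext i j
  by_cases h : a j ≤ i ∧ i < b j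
  · exact (heq (i, j) ((mem_columnCells hJ _).2 h)).symm
  · rw [T.zero i j (by rwa [hcell]), columnFilling, if_neg h]

theorem lrCoeff_eq_one_of_columns {lam mu nu : ℕ → ℕ} (J : ℕ) (a b : ℕ → ℕ)
    (hcell : ∀ i j, IsCell lam mu i j ↔ a j ≤ i ∧ i < b j)
    (hJ : ∀ j, J ≤ j → b j ≤ a j) (ha : Antitone a)
    (hnu : ∀ m, 1 ≤ m → ((Finset.range J).filter fun j => a j + m ≤ b j).card = nu (m - 1)) :
    lrCoeff lam mu nu = 1 := by
  refine Nat.card_eq_one_iff_unique.2 ⟨⟨fun T T' => LRTableau.ext_entry_s15 ?_⟩,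
    ⟨columnTableau hcell hJ ha hnu⟩⟩
  rw [T.entry_eq_columnFilling hcell hJ hnu, T'.entry_eq_columnFilling hcell hJ hnu]

/-- Each column of a tableau contains at most one entry equal to `1`. -/
theorem lrCoeff_eq_zero_of_columns {lam mu nu : ℕ → ℕ} (J : ℕ) (a b : ℕ → ℕ)
    (hcell : ∀ i j, IsCell lam mu i j ↔ a j ≤ i ∧ i < b j)
    (hJ : ∀ j, J ≤ j → b j ≤ a j)
    (hnu : ((Finset.range J).filter fun j => a j + 1 ≤ b j).card < nu 0) :
    lrCoeff lam mu nu = 0 := by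
  have : IsEmpty (LRTableau lam mu nu) := ⟨fun T => by
    refine hnu.not_ge ?_
    rw [← T.content 1 le_rfl, Nat.subtype_card
      ((columnCells J a b).filter fun p => T.entry p.1 p.2 = 1)
      fun p => by rw [Finset.mem_filter, mem_columnCells hJ, hcell]]
    refine Finset.card_le_card_of_injOn Prod.snd ?_ ?_
    · rintro ⟨i, j⟩ h
      simp only [Finset.coe_filter, Set.mem_ofPred_eq, mem_columnCells hJ, Finset.mem_range] at h ⊢
      refine ⟨?_, by omega⟩
      by_contra hj
      have := hJ j (by omega)
      omega
    · rintro ⟨i, j⟩ h ⟨i', j'⟩ h' heq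
      simp only [Finset.coe_filter, Set.mem_ofPred_eq, mem_columnCells hJ, ← hcell] at h h' heq
      subst heq
      rw [Prod.mk.injEq]
      refine ⟨?_, rfl⟩
      rcases lt_trichotomy i i' with hlt | heq | hlt
      · have := T.col_strict i i' j hlt h.1 h'.1
        omega
      · exact heq
      · have := T.col_strict i' i j hlt h'.1 h.1
        omega⟩
  exact Nat.card_of_isEmpty

/-- The lengths `r, q, p, s` of the columns of a partition with parts at most `4`. -/
def columnLengths (r q p s : ℕ) (j : ℕ) : ℕ :=
  if j = 0 then r else if j = 1 then q else if j = 2 then p else if j = 3 then s else 0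

lemma antitone_columnLengths {r q p s : ℕ} (hq : q ≤ r) (hp : p ≤ q) (hs : s ≤ p) :
    Antitone (columnLengths r q p s) := by
  intro j j' h
  unfold columnLengths
  split_ifs <;> omega

lemma columnLengths_le_of_four_le {r q p s r' q' p' s' : ℕ} (j : ℕ) (hj : 4 ≤ j) :
    columnLengths r q p s j ≤ columnLengths r' q' p' s' j := by
  unfold columnLengths
  split_ifs <;> omega

lemma card_filter_columnLengths (r q p s r' q' p' s' m : ℕ) :
    ((Finset.range 4).filter fun j =>
      columnLengths r' q' p' s' j + m ≤ columnLengths r q p s j).card =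
      (if r' + m ≤ r then 1 else 0) + (if q' + m ≤ q then 1 else 0) +
        (if p' + m ≤ p then 1 else 0) + (if s' + m ≤ s then 1 else 0) := by
  rw [Finset.card_filter, Finset.sum_range_succ, Finset.sum_range_succ, Finset.sum_range_succ,
    Finset.sum_range_one]
  rfl

/-- for `λ' = (3, 2^(k-1))` with `k ≥ 3` and each of `β'₁ = (3^k, 1^k)`,
`β'₂ = (4^k)`, the Littlewood–Richardson coefficients
`c^{β'}_{λ'_(1), λ'_(k)}, c^{β'}_{λ'_(k), λ'_(k)}, c^{β'}_{λ'_(1), λ'_(1)},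
c^{β'}_{λ', λ'_(1,k)}, c^{β'}_{λ', λ'_(k,↑)}, c^{β'}_{λ', λ'_(k,←)}` are
`0, 1, 1, 1, 0, 0` respectively. -/
theorem conj_lr_special (k : ℕ) (hk : 3 ≤ k) (β : ℕ → ℕ)
    (hβ : β = (fun i => if i < k then 3 else if i < 2 * k then 1 else 0) ∨
      β = fun i => if i < k then 4 else 0) :
    lrCoeff β (lamC1 k) (lamCK k) = 0 ∧
    lrCoeff β (lamCK k) (lamCK k) = 1 ∧
    lrCoeff β (lamC1 k) (lamC1 k) = 1 ∧
    lrCoeff β (lamC k) (lamC1K k) = 1 ∧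
    lrCoeff β (lamC k) (lamCUp k) = 0 ∧
    lrCoeff β (lamC k) (lamCLeft k) = 0 := by
  obtain ⟨r, s, hrs, hβ⟩ : ∃ r s, (r = 2 * k ∧ s = 0 ∨ r = k ∧ s = k) ∧
      ∀ i j, j < β i ↔ i < columnLengths r k k s j := by
    rcases hβ with rfl | rfl
    · refine ⟨2 * k, 0, by omega, fun i j => ?_⟩
      simp only [columnLengths]
      split_ifs <;> omega
    · refine ⟨k, k, by omega, fun i j => ?_⟩
      simp only [columnLengths]
      split_ifs <;> omega
  have hC1 : ∀ i j, IsCell β (lamC1 k) i j ↔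
      columnLengths k k 0 0 j ≤ i ∧ i < columnLengths r k k s j := by
    refine fun i j => and_congr ?_ (hβ i j)
    simp only [columnLengths, lamC1]
    split_ifs <;> omega
  have hCK : ∀ i j, IsCell β (lamCK k) i j ↔
      columnLengths k (k - 1) 1 0 j ≤ i ∧ i < columnLengths r k k s j := by
    refine fun i j => and_congr ?_ (hβ i j)
    simp only [columnLengths, lamCK]
    split_ifs <;> omega
  have hC : ∀ i j, IsCell β (lamC k) i j ↔
      columnLengths k k 1 0 j ≤ i ∧ i < columnLengths r k k s j := by
    refine fun i j => and_congr ?_ (hβ i j)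
    simp only [columnLengths, lamC]
    split_ifs <;> omega
  refine ⟨lrCoeff_eq_zero_of_columns 4 _ _ hC1 columnLengths_le_of_four_le ?_,
    lrCoeff_eq_one_of_columns 4 _ _ hCK columnLengths_le_of_four_le
      (antitone_columnLengths (by omega) (by omega) (by omega)) fun m hm => ?_,
    lrCoeff_eq_one_of_columns 4 _ _ hC1 columnLengths_le_of_four_le
      (antitone_columnLengths (by omega) (by omega) (by omega)) fun m hm => ?_,
    lrCoeff_eq_one_of_columns 4 _ _ hC columnLengths_le_of_four_le
      (antitone_columnLengths (by omega) (by omega) (by omega)) fun m hm => ?_,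
    lrCoeff_eq_zero_of_columns 4 _ _ hC columnLengths_le_of_four_le ?_,
    lrCoeff_eq_zero_of_columns 4 _ _ hC columnLengths_le_of_four_le ?_⟩
  all_goals
    rw [card_filter_columnLengths]
    simp only [lamCK, lamC1, lamC1K, lamCUp, lamCLeft, if_true]
    split_ifs <;> omega

end
end

section
/- Let p and q be homogeneous symmetric polynomials in n variables, each Schur positive, such that both (p^{(1)})^2 − p·p^{(2)} and (q^{(1)})^2 − q·q^{(2)} are Schur positive. Then ((pq)^{(1)})^2 − (pq)·(pq)^{(2)} is Schur positive. -/
open MvPolynomial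

noncomputable section

/-- The complete homogeneous symmetric polynomial in `n` variables, indexed by an
integer (by convention it is `0` for negative indices). -/
def hInt (n : ℕ) (k : ℤ) : MvPolynomial (Fin n) ℚ :=
  if 0 ≤ k then MvPolynomial.hsymm (Fin n) ℚ k.toNat else 0

/-- The Schur polynomial of a partition in `n` variables, via the Jacobi-Trudi identity
`s_lam = det (h_{lam_i + j - i})`. -/
def schur (n : ℕ) (lam : ℕ → ℕ) : MvPolynomial (Fin n) ℚ :=
  (Matrix.of fun i j : Fin (partLen lam) =>
    hInt n ((lam i : ℤ) + ((j : ℕ) : ℤ) - ((i : ℕ) : ℤ))).det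

/-- The `i`-th derived polynomial `p^{(i)}` of `p`, defined by the identity
`p (x₁ + t, …, xₙ + t) = ∑ i, t^i • p^{(i)} (x₁, …, xₙ)`: substituting `X j + t` for each
variable `X j` yields a polynomial in `t` whose `t^i`-coefficient is `p^{(i)}`. -/
def derived (n i : ℕ) (p : MvPolynomial (Fin n) ℚ) : MvPolynomial (Fin n) ℚ :=
  (MvPolynomial.aeval
    (fun j : Fin n => (Polynomial.C (X j) + Polynomial.X : Polynomial (MvPolynomial (Fin n) ℚ)))
    p).coeff i

/-- A symmetric polynomial is Schur positive if it is a linear combination of Schur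
polynomials (of partitions) with non-negative coefficients. -/
def SchurPositive (n : ℕ) (f : MvPolynomial (Fin n) ℚ) : Prop :=
  ∃ (S : Finset (ℕ → ℕ)) (c : (ℕ → ℕ) → ℚ),
    (∀ μ ∈ S, IsPartition μ) ∧ (∀ μ ∈ S, 0 ≤ c μ) ∧ f = ∑ μ ∈ S, c μ • schur n μ

/-- The generating series of the complete homogeneous symmetric polynomials. -/
def hsymmSeries (n : ℕ) : PowerSeries (MvPolynomial (Fin n) ℚ) :=
  PowerSeries.mk (hsymm (Fin n) ℚ)

lemma mk_pow_mul_one_sub {R : Type*} [CommRing R] (a : R) :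
    PowerSeries.mk (fun m => a ^ m) * (1 - PowerSeries.C a * PowerSeries.X) = 1 := by
  ext m
  rw [mul_sub, mul_one, ← mul_assoc]
  cases m with
  | zero => simp
  | succ m =>
    simp [PowerSeries.coeff_succ_mul_X, PowerSeries.coeff_one, pow_succ]

lemma hsymmSeries_eq_prod (n : ℕ) :
    hsymmSeries n = ∏ i : Fin n, PowerSeries.mk fun m => (X i : MvPolynomial (Fin n) ℚ) ^ m := by
  ext1 m
  rw [PowerSeries.coeff_prod, hsymmSeries, PowerSeries.coeff_mk, hsymm]
  refine Finset.sum_bij (fun s _ => Multiset.toFinsupp s.1) ?_ ?_ ?_ ?_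
  · intro s _
    have h := Finsupp.card_toMultiset (Multiset.toFinsupp s.1)
    rw [Multiset.toFinsupp_toMultiset, s.2] at h
    rw [Finset.mem_finsuppAntidiag']
    exact ⟨h.symm, Finset.subset_univ _⟩
  · intro s _ t _ h
    exact Subtype.ext (Multiset.toFinsupp.injective h)
  · intro f hf
    rw [Finset.mem_finsuppAntidiag'] at hf
    exact ⟨⟨Finsupp.toMultiset f, by rw [Finsupp.card_toMultiset]; exact hf.1⟩,
      Finset.mem_univ _, Finsupp.toMultiset_toFinsupp f⟩
  · intro s _
    rw [Finset.prod_multiset_map_count]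
    simp only [PowerSeries.coeff_mk, Multiset.toFinsupp_apply]
    refine Finset.prod_subset (Finset.subset_univ _) fun i _ hi => ?_
    rw [Multiset.count_eq_zero_of_notMem (by simpa using hi), pow_zero]

lemma hsymmSeries_mul_prod (n : ℕ) :
    hsymmSeries n * ∏ i : Fin n, (1 - PowerSeries.C (X i) * PowerSeries.X) = 1 := by
  rw [hsymmSeries_eq_prod, ← Finset.prod_mul_distrib]
  exact Finset.prod_eq_one fun i _ => mk_pow_mul_one_sub _

lemma hsymmSeries_mul_prod_erase (n : ℕ) (l : Fin n) :
    hsymmSeries n * ∏ i ∈ Finset.univ.erase l, (1 - PowerSeries.C (X i) * PowerSeries.X) =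
      PowerSeries.mk fun m => X l ^ m := by
  have h := hsymmSeries_mul_prod n
  rw [← Finset.mul_prod_erase _ _ (Finset.mem_univ l)] at h
  calc _ = PowerSeries.mk (fun m => X l ^ m) * (1 - PowerSeries.C (X l) * PowerSeries.X) *
        (hsymmSeries n * ∏ i ∈ Finset.univ.erase l,
          (1 - PowerSeries.C (X i) * PowerSeries.X)) := by rw [mk_pow_mul_one_sub, one_mul]
    _ = PowerSeries.mk (fun m => X l ^ m) * (hsymmSeries n *
        ((1 - PowerSeries.C (X l) * PowerSeries.X) * ∏ i ∈ Finset.univ.erase l,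
          (1 - PowerSeries.C (X i) * PowerSeries.X))) := by ring
    _ = _ := by rw [h, mul_one]

lemma coeff_prod_one_sub_eq_zero {R ι : Type*} [CommRing R] (a : ι → R) (s : Finset ι) {k : ℕ}
    (hk : s.card < k) :
    PowerSeries.coeff k (∏ i ∈ s, (1 - PowerSeries.C (a i) * PowerSeries.X)) = 0 := by
  classical
  induction s using Finset.induction_on generalizing k with
  | empty => simp [PowerSeries.coeff_one, show k ≠ 0 by rintro rfl; simp at hk]
  | insert i s hi ih =>
    rw [Finset.card_insert_of_notMem hi] at hk
    obtain ⟨k, rfl⟩ : ∃ m, k = m + 1 := ⟨k - 1, by omega⟩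
    rw [Finset.prod_insert hi, sub_mul, one_mul, mul_assoc, mul_comm PowerSeries.X, map_sub,
      PowerSeries.coeff_C_mul, PowerSeries.coeff_succ_mul_X, ih (by omega), ih (by omega)]
    simp

lemma hInt_of_neg (n : ℕ) {k : ℤ} (hk : k < 0) : hInt n k = 0 := if_neg (by omega)

lemma hInt_zero (n : ℕ) : hInt n 0 = 1 := by simp [hInt]

lemma hInt_natCast (n k : ℕ) : hInt n k = hsymm (Fin n) ℚ k := by simp [hInt]

lemma coeff_hsymmSeries_mul (n N m : ℕ) (Q : PowerSeries (MvPolynomial (Fin n) ℚ))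
    (hQ : ∀ k, N ≤ k → PowerSeries.coeff k Q = 0) :
    PowerSeries.coeff m (hsymmSeries n * Q) =
      ∑ j : Fin N, hInt n ((m : ℤ) + ((j : ℕ) : ℤ) + 1 - N) *
        PowerSeries.coeff (N - 1 - (j : ℕ)) Q := by
  have h1 : ∑ j : Fin N, hInt n ((m : ℤ) + ((j : ℕ) : ℤ) + 1 - N) *
        PowerSeries.coeff (N - 1 - (j : ℕ)) Q =
      ∑ k ∈ Finset.range N, hInt n ((m : ℤ) - k) * PowerSeries.coeff k Q := by
    rw [← Finset.sum_range_reflect, Finset.sum_range]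
    refine Finset.sum_congr rfl fun j _ => ?_
    congr 2
    have := j.2
    push_cast [Nat.cast_sub (show (j : ℕ) ≤ N - 1 by omega), Nat.cast_sub (show 1 ≤ N by omega)]
    ring
  have h2 : ∑ k ∈ Finset.range N, hInt n ((m : ℤ) - k) * PowerSeries.coeff k Q =
      ∑ k ∈ Finset.range (N + (m + 1)), hInt n ((m : ℤ) - k) * PowerSeries.coeff k Q := by
    refine Finset.sum_subset (Finset.range_subset_range.2 (by omega)) fun k _ hk => ?_
    rw [hQ k (by simpa using hk), mul_zero]
  have h3 : ∑ k ∈ Finset.range (m + 1), hInt n ((m : ℤ) - k) * PowerSeries.coeff k Q =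
      ∑ k ∈ Finset.range (N + (m + 1)), hInt n ((m : ℤ) - k) * PowerSeries.coeff k Q := by
    refine Finset.sum_subset (Finset.range_subset_range.2 (by omega)) fun k _ hk => ?_
    rw [hInt_of_neg n (by simp at hk; omega), zero_mul]
  rw [h1, h2, ← h3, mul_comm, PowerSeries.coeff_mul,
    Finset.Nat.sum_antidiagonal_eq_sum_range_succ_mk]
  refine Finset.sum_congr rfl fun k hk => ?_
  rw [← Nat.cast_sub (by simp at hk; omega), hInt_natCast, hsymmSeries, PowerSeries.coeff_mk,
    mul_comm]

/-- The `N × N` Jacobi-Trudi determinant of `lam`. -/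
def jacobiTrudi (n N : ℕ) (lam : ℕ → ℕ) : MvPolynomial (Fin n) ℚ :=
  (Matrix.of fun i j : Fin N => hInt n ((lam i : ℤ) + ((j : ℕ) : ℤ) - ((i : ℕ) : ℤ))).det

lemma jacobiTrudi_succ (n N : ℕ) (lam : ℕ → ℕ) (h : lam N = 0) :
    jacobiTrudi n (N + 1) lam = jacobiTrudi n N lam := by
  rw [jacobiTrudi, Matrix.det_succ_row _ (Fin.last N), Finset.sum_eq_single (Fin.last N)]
  · simp only [Matrix.of_apply, Fin.val_last, h, Nat.cast_zero, zero_add, sub_self, hInt_zero,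
      ← two_mul, pow_mul, neg_one_sq, one_pow, one_mul, Fin.succAbove_last]
    rfl
  · intro j _ hj
    have : (j : ℕ) < N := Fin.val_lt_last hj
    rw [Matrix.of_apply, hInt_of_neg]
    · simp
    · simp [h, this]
  · simp

lemma jacobiTrudi_eq (n N M : ℕ) (lam : ℕ → ℕ) (hNM : N ≤ M) (h : ∀ i, N ≤ i → lam i = 0) :
    jacobiTrudi n M lam = jacobiTrudi n N lam := by
  induction M, hNM using Nat.le_induction with
  | base => rfl
  | succ M hM ih => rw [jacobiTrudi_succ n M lam (h M hM), ih]

lemma IsPartition.apply_partLen {lam : ℕ → ℕ} (h : IsPartition lam) : lam (partLen lam) = 0 := by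
  obtain ⟨N, hN⟩ := h.2
  exact Nat.sInf_mem (s := {N | lam N = 0}) ⟨N, hN N le_rfl⟩

lemma IsPartition.eq_zero_of_le {lam : ℕ → ℕ} (h : IsPartition lam) {m i : ℕ} (hm : lam m = 0)
    (hi : m ≤ i) : lam i = 0 :=
  Nat.eq_zero_of_le_zero ((h.1 hi).trans hm.le)

lemma schur_eq_jacobiTrudi (n N : ℕ) {lam : ℕ → ℕ} (h : IsPartition lam) (hN : lam N = 0) :
    schur n lam = jacobiTrudi n N lam :=
  (jacobiTrudi_eq n (partLen lam) N lam (Nat.sInf_le hN)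
    fun _ => h.eq_zero_of_le h.apply_partLen).symm

lemma schur_eq_zero {n : ℕ} {lam : ℕ → ℕ} (h : IsPartition lam) (hn : lam n ≠ 0) :
    schur n lam = 0 := by
  set N := partLen lam with hN
  have hnN : n < N := by
    by_contra! hle
    exact hn (h.eq_zero_of_le h.apply_partLen hle)
  set Q : PowerSeries (MvPolynomial (Fin n) ℚ) :=
    ∏ i : Fin n, (1 - PowerSeries.C (X i) * PowerSeries.X) with hQ
  change Matrix.det (n := Fin N) _ = 0
  rw [← Matrix.exists_mulVec_eq_zero_iff]
  refine ⟨fun j => PowerSeries.coeff (N - 1 - (j : ℕ)) Q, fun h0 => ?_, ?_⟩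
  · have := congrFun h0 ⟨N - 1, by omega⟩
    simp [hQ, map_prod] at this
  · ext1 i
    have hi : lam i ≠ 0 := fun h0 => by
      have : N ≤ i := Nat.sInf_le h0
      omega
    have key := coeff_hsymmSeries_mul n N (lam i + (N - 1 - i)) Q
      fun k hk => coeff_prod_one_sub_eq_zero _ _ (by simpa using lt_of_lt_of_le hnN hk)
    rw [hQ, hsymmSeries_mul_prod, PowerSeries.coeff_one, if_neg (by omega)] at key
    rw [Pi.zero_apply, key, Matrix.mulVec, dotProduct]
    refine Finset.sum_congr rfl fun j _ => ?_
    rw [Matrix.of_apply]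
    congr 2
    omega

/-- The alternant `det (x_i ^ α_j)`. -/
def alternant (n : ℕ) (α : Fin n → ℕ) : MvPolynomial (Fin n) ℚ :=
  (Matrix.of fun i j : Fin n => (X j : MvPolynomial (Fin n) ℚ) ^ α i).det

/-- The exponent vector `lam + ρ`, where `ρ = (n - 1, …, 1, 0)`. -/
def addRho (n : ℕ) (lam : ℕ → ℕ) (i : Fin n) : ℕ := lam i + (n - 1 - i)

lemma jacobiTrudi_mul_det (n : ℕ) (lam : ℕ → ℕ) :
    jacobiTrudi n n lam * (Matrix.of fun j l : Fin n => PowerSeries.coeff (n - 1 - (j : ℕ))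
      (∏ i ∈ Finset.univ.erase l, (1 - PowerSeries.C (X i : MvPolynomial (Fin n) ℚ) *
        PowerSeries.X))).det = alternant n (addRho n lam) := by
  rw [jacobiTrudi, ← Matrix.det_mul, alternant]
  congr 1
  ext1 i l
  have key := coeff_hsymmSeries_mul n n (addRho n lam i)
    (∏ i ∈ Finset.univ.erase l, (1 - PowerSeries.C (X i) * PowerSeries.X))
    fun k hk => coeff_prod_one_sub_eq_zero _ _ (by
      rw [Finset.card_erase_of_mem (Finset.mem_univ l), Finset.card_fin]
      have := l.2
      omega)
  rw [hsymmSeries_mul_prod_erase, PowerSeries.coeff_mk] at key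
  rw [Matrix.of_apply, key, Matrix.mul_apply]
  refine Finset.sum_congr rfl fun j _ => ?_
  simp only [Matrix.of_apply, addRho]
  congr 2
  omega

/-- The bialternant formula. -/
lemma schur_mul_alternant {n : ℕ} {lam : ℕ → ℕ} (h : IsPartition lam) (hn : lam n = 0) :
    schur n lam * alternant n (addRho n 0) = alternant n (addRho n lam) := by
  rw [schur_eq_jacobiTrudi n n h hn, ← jacobiTrudi_mul_det n lam, ← jacobiTrudi_mul_det n 0,
    jacobiTrudi_eq n 0 n 0 (Nat.zero_le n) fun _ _ => rfl]
  simp [jacobiTrudi]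

lemma alternant_addRho_zero_ne_zero (n : ℕ) : alternant n (addRho n 0) ≠ 0 := by
  have h : (Matrix.of fun i j : Fin n => (X j : MvPolynomial (Fin n) ℚ) ^ addRho n 0 i) =
      (Matrix.vandermonde X).transpose.submatrix Fin.revPerm id := by
    ext1 i j
    simp only [Matrix.of_apply, addRho, Matrix.submatrix_apply, Matrix.transpose_apply,
      Matrix.vandermonde_apply, Fin.revPerm_apply, Fin.val_rev, id, Pi.zero_apply, zero_add]
    congr 1
    omega
  rw [alternant, h, Matrix.det_permute, Matrix.det_transpose]
  refine mul_ne_zero ?_ (Matrix.det_vandermonde_ne_zero_iff.2 (X_injective))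
  exact_mod_cast (Equiv.Perm.sign (Fin.revPerm (n := n))).ne_zero

/-- Antisymmetrization of a polynomial. -/
def antisymmetrize (n : ℕ) : MvPolynomial (Fin n) ℚ →ₗ[ℚ] MvPolynomial (Fin n) ℚ :=
  ∑ w : Equiv.Perm (Fin n), (Equiv.Perm.sign w : ℤ) • (rename w).toLinearMap

lemma antisymmetrize_apply (n : ℕ) (f : MvPolynomial (Fin n) ℚ) :
    antisymmetrize n f = ∑ w : Equiv.Perm (Fin n), (Equiv.Perm.sign w : ℤ) • rename w f := by
  simp [antisymmetrize]

lemma antisymmetrize_prod_X_pow (n : ℕ) (α : Fin n → ℕ) :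
    antisymmetrize n (∏ i, X i ^ α i) = alternant n α := by
  rw [alternant, Matrix.det_apply, antisymmetrize_apply, ← Equiv.sum_comp (Equiv.inv _)]
  refine Finset.sum_congr rfl fun w _ => ?_
  simp only [Equiv.inv_apply, Equiv.Perm.sign_inv, map_prod, map_pow, rename_X, Matrix.of_apply]
  rw [Units.smul_def, ← Equiv.prod_comp w]
  simp

lemma antisymmetrize_mul (n : ℕ) (f g : MvPolynomial (Fin n) ℚ) (hg : g.IsSymmetric) :
    antisymmetrize n (f * g) = antisymmetrize n f * g := by
  simp only [antisymmetrize_apply, Finset.sum_mul, map_mul, hg _, smul_mul_assoc]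

lemma alternant_comp (n : ℕ) (α : Fin n → ℕ) (σ : Equiv.Perm (Fin n)) :
    alternant n (α ∘ σ) = (Equiv.Perm.sign σ : ℤ) • alternant n α := by
  rw [alternant, alternant, zsmul_eq_mul, ← Matrix.det_permute]
  rfl

lemma alternant_eq_zero (n : ℕ) (α : Fin n → ℕ) {i j : Fin n} (hij : i ≠ j) (h : α i = α j) :
    alternant n α = 0 :=
  Matrix.det_zero_of_row_eq hij (by ext1 k; simp [h])

/-! ### Derivatives -/

/-- The derivation `∑ ∂/∂x_i`. -/
def sumPDeriv (n : ℕ) : Derivation ℚ (MvPolynomial (Fin n) ℚ) (MvPolynomial (Fin n) ℚ) :=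
  ∑ i, pderiv i

lemma sumPDeriv_apply (n : ℕ) (f : MvPolynomial (Fin n) ℚ) :
    sumPDeriv n f = ∑ i, pderiv i f := by
  rw [sumPDeriv, ← Derivation.coeFnAddMonoidHom_apply, map_sum, Finset.sum_apply]
  rfl

lemma derived_add (n i : ℕ) (p q : MvPolynomial (Fin n) ℚ) :
    derived n i (p + q) = derived n i p + derived n i q := by
  simp [derived]

lemma derived_zero (n : ℕ) (p : MvPolynomial (Fin n) ℚ) : derived n 0 p = p := by
  rw [derived, Polynomial.coeff_zero_eq_eval_zero]
  induction p using MvPolynomial.induction_on with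
  | C a => simp [MvPolynomial.algebraMap_eq, Polynomial.algebraMap_apply]
  | add p q hp hq => rw [map_add, Polynomial.eval_add, hp, hq]
  | mul_X p i hp => rw [map_mul, Polynomial.eval_mul, hp]; simp

lemma derived_mul (n i : ℕ) (p q : MvPolynomial (Fin n) ℚ) :
    derived n i (p * q) =
      ∑ k ∈ Finset.HasAntidiagonal.antidiagonal i, derived n k.1 p * derived n k.2 q := by
  simp only [derived, map_mul, Polynomial.coeff_mul]

lemma derived_one_mul (n : ℕ) (p q : MvPolynomial (Fin n) ℚ) :
    derived n 1 (p * q) = p * derived n 1 q + derived n 1 p * q := by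
  rw [derived_mul, Finset.Nat.antidiagonal_succ, Finset.sum_cons, Finset.sum_map]
  simp [derived_zero]

lemma derived_two_mul (n : ℕ) (p q : MvPolynomial (Fin n) ℚ) :
    derived n 2 (p * q) =
      p * derived n 2 q + derived n 1 p * derived n 1 q + derived n 2 p * q := by
  rw [derived_mul, Finset.Nat.antidiagonal_succ, Finset.sum_cons, Finset.sum_map,
    Finset.Nat.antidiagonal_succ, Finset.sum_cons, Finset.sum_map]
  simp [derived_zero, add_assoc]

lemma derived_one_eq (n : ℕ) (p : MvPolynomial (Fin n) ℚ) : derived n 1 p = sumPDeriv n p := by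
  induction p using MvPolynomial.induction_on with
  | C a => simp [derived, Polynomial.algebraMap_apply]
  | add p q hp hq => rw [derived_add, hp, hq, map_add]
  | mul_X p i hp =>
    rw [derived_one_mul, hp, Derivation.leibniz, smul_eq_mul, smul_eq_mul, mul_comm (X i)]
    congr 2
    simp [derived, sumPDeriv_apply, pderiv_X, Pi.single_apply]

lemma sumPDeriv_rename (n : ℕ) (σ : Equiv.Perm (Fin n)) (f : MvPolynomial (Fin n) ℚ) :
    sumPDeriv n (rename σ f) = rename σ (sumPDeriv n f) := by
  simp only [sumPDeriv_apply, map_sum]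
  rw [← Equiv.sum_comp σ]
  exact Finset.sum_congr rfl fun i _ => pderiv_rename σ.injective i f

lemma sumPDeriv_antisymmetrize (n : ℕ) (f : MvPolynomial (Fin n) ℚ) :
    sumPDeriv n (antisymmetrize n f) = antisymmetrize n (sumPDeriv n f) := by
  simp only [antisymmetrize_apply, map_sum, map_zsmul, sumPDeriv_rename]

lemma sumPDeriv_alternant (n : ℕ) (α : Fin n → ℕ) :
    sumPDeriv n (alternant n α) =
      ∑ i, (α i : ℚ) • alternant n (α - Pi.single i 1) := by
  rw [← antisymmetrize_prod_X_pow, sumPDeriv_antisymmetrize, sumPDeriv_apply, map_sum]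
  refine Finset.sum_congr rfl fun i _ => ?_
  rw [← antisymmetrize_prod_X_pow, ← map_smul]
  congr 1
  have h (β : Fin n → ℕ) : (∏ i, X i ^ β i : MvPolynomial (Fin n) ℚ) =
      monomial (Finsupp.equivFunOnFinite.symm β) 1 := by
    rw [monomial_eq]
    simp [Finsupp.prod_fintype]
  rw [h, h, pderiv_monomial, smul_monomial]
  congr 1
  · congr 1
    ext j
    simp [Finsupp.single_apply, Pi.single_apply, eq_comm]
  · simp

/-! ### The cone of Schur positive polynomials -/

lemma SchurPositive.zero (n : ℕ) : SchurPositive n 0 := ⟨∅, 0, by simp, by simp, by simp⟩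

lemma IsPartition.schurPositive {lam : ℕ → ℕ} (h : IsPartition lam) (n : ℕ) :
    SchurPositive n (schur n lam) :=
  ⟨{lam}, 1, by simpa using h, by simp, by simp⟩

lemma SchurPositive.smul {n : ℕ} {f : MvPolynomial (Fin n) ℚ} (hf : SchurPositive n f) {a : ℚ}
    (ha : 0 ≤ a) : SchurPositive n (a • f) := by
  obtain ⟨S, c, hS, hc, rfl⟩ := hf
  exact ⟨S, a • c, hS, fun μ hμ => mul_nonneg ha (hc μ hμ), by
    simp [Finset.smul_sum, smul_smul]⟩

lemma SchurPositive.add {n : ℕ} {f g : MvPolynomial (Fin n) ℚ} (hf : SchurPositive n f)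
    (hg : SchurPositive n g) : SchurPositive n (f + g) := by
  classical
  obtain ⟨S, c, hS, hc, rfl⟩ := hf
  obtain ⟨T, d, hT, hd, rfl⟩ := hg
  refine ⟨S ∪ T, fun μ => (if μ ∈ S then c μ else 0) + if μ ∈ T then d μ else 0, ?_, ?_, ?_⟩
  · intro μ hμ
    exact (Finset.mem_union.1 hμ).elim (hS μ) (hT μ)
  · intro μ _
    refine add_nonneg ?_ ?_ <;> split_ifs with h <;> simp [*]
  · simp only [add_smul, ite_smul, zero_smul, Finset.sum_add_distrib, Finset.sum_ite_mem,
      Finset.union_inter_cancel_left, Finset.union_inter_cancel_right]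

lemma SchurPositive.sum {n : ℕ} {ι : Type*} (S : Finset ι) (f : ι → MvPolynomial (Fin n) ℚ)
    (h : ∀ i ∈ S, SchurPositive n (f i)) : SchurPositive n (∑ i ∈ S, f i) :=
  Finset.sum_induction f (SchurPositive n) (fun _ _ => SchurPositive.add) (SchurPositive.zero n) h

/-- To check an additive property of Schur positive polynomials stable under nonnegative scaling,
it suffices to check it on the Schur polynomials of partitions with at most `n` parts. -/
lemma SchurPositive.induction {n : ℕ} {P : MvPolynomial (Fin n) ℚ → Prop} (zero : P 0)
    (add : ∀ f g, P f → P g → P (f + g)) (smul : ∀ (a : ℚ) f, 0 ≤ a → P f → P (a • f))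
    (schur : ∀ lam, IsPartition lam → lam n = 0 → P (schur n lam))
    {f : MvPolynomial (Fin n) ℚ} (hf : SchurPositive n f) : P f := by
  obtain ⟨S, c, hS, hc, rfl⟩ := hf
  refine Finset.sum_induction _ P add zero fun μ hμ => smul _ _ (hc μ hμ) ?_
  by_cases hn : μ n = 0
  · exact schur μ (hS μ hμ) hn
  · rwa [schur_eq_zero (hS μ hμ) hn]

lemma smul_alternant_sub_single_eq_zero (n : ℕ) {lam : ℕ → ℕ} (hn : lam n = 0) (i : Fin n)
    (h : lam i = lam (i + 1)) :
    (addRho n lam i : ℚ) • alternant n (addRho n lam - Pi.single i 1) = 0 := by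
  by_cases hi : (i : ℕ) + 1 = n
  · have h0 : addRho n lam i = 0 := by
      rw [addRho, h, hi, hn]
      omega
    rw [h0, Nat.cast_zero, zero_smul]
  · have hin := i.2
    have hne : i ≠ ⟨i + 1, by omega⟩ := by simp [Fin.ext_iff]
    rw [alternant_eq_zero n _ hne, smul_zero]
    simp only [Pi.sub_apply, Pi.single_eq_same, Pi.single_eq_of_ne hne.symm, addRho]
    omega

lemma sumPDeriv_alternant_addRho_zero (n : ℕ) :
    sumPDeriv n (alternant n (addRho n 0)) = 0 := by
  rw [sumPDeriv_alternant]
  exact Finset.sum_eq_zero fun i _ => smul_alternant_sub_single_eq_zero n rfl i rfl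

lemma IsPartition.update_pred {lam : ℕ → ℕ} (h : IsPartition lam) {i : ℕ}
    (hi : lam (i + 1) < lam i) : IsPartition (Function.update lam i (lam i - 1)) := by
  refine ⟨antitone_nat_of_succ_le fun k => ?_, ?_⟩
  · have := h.1 (Nat.le_succ k)
    simp only [Function.update_apply]
    split_ifs <;> subst_vars <;> simp at * <;> omega
  · obtain ⟨N, hN⟩ := h.2
    refine ⟨N, fun k hk => ?_⟩
    rw [Function.update_apply]
    split_ifs with hki
    · rw [← hki, hN k hk]
    · exact hN k hk

lemma IsPartition.schurPositive_derived_one {lam : ℕ → ℕ} (h : IsPartition lam) {n : ℕ}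
    (hn : lam n = 0) : SchurPositive n (derived n 1 (schur n lam)) := by
  have key : derived n 1 (schur n lam) * alternant n (addRho n 0) =
      ∑ i, (addRho n lam i : ℚ) • alternant n (addRho n lam - Pi.single i 1) := by
    rw [← sumPDeriv_alternant, ← schur_mul_alternant h hn, Derivation.leibniz,
      sumPDeriv_alternant_addRho_zero, derived_one_eq]
    simp [mul_comm]
  have term (i : Fin n) : ∃ f, SchurPositive n f ∧
      (addRho n lam i : ℚ) • alternant n (addRho n lam - Pi.single i 1) =
        f * alternant n (addRho n 0) := by
    by_cases hi : lam i = lam (i + 1)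
    · exact ⟨0, .zero n, by rw [smul_alternant_sub_single_eq_zero n hn i hi, zero_mul]⟩
    · have hlt : lam (i + 1) < lam i := lt_of_le_of_ne (h.1 (Nat.le_succ _)) (Ne.symm hi)
      refine ⟨_, ((h.update_pred hlt).schurPositive n).smul (Nat.cast_nonneg (addRho n lam i)), ?_⟩
      rw [smul_mul_assoc, schur_mul_alternant (h.update_pred hlt)
        (by rw [Function.update_of_ne i.2.ne', hn])]
      congr 2
      ext j
      by_cases hj : j = i
      · subst hj
        simp only [Pi.sub_apply, Pi.single_eq_same, addRho, Function.update_self]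
        omega
      · simp [addRho, Function.update_of_ne (Fin.val_ne_of_ne hj), Pi.single_eq_of_ne hj]
  choose f hf hfe using term
  rw [Finset.sum_congr rfl fun i _ => hfe i, ← Finset.sum_mul] at key
  rw [mul_right_cancel₀ (alternant_addRho_zero_ne_zero n) key]
  exact SchurPositive.sum _ _ fun i _ => hf i

lemma SchurPositive.derived_one {n : ℕ} {f : MvPolynomial (Fin n) ℚ} (hf : SchurPositive n f) :
    SchurPositive n (derived n 1 f) := by
  refine hf.induction (P := fun f => SchurPositive n (derived n 1 f)) ?_ ?_ ?_ ?_
  · simpa [derived] using SchurPositive.zero n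
  · intro f g hf hg
    rw [derived_add]
    exact hf.add hg
  · intro a f ha hf
    rw [derived_one_eq] at hf ⊢
    rw [Derivation.map_smul]
    exact hf.smul ha
  · exact fun lam h hn => h.schurPositive_derived_one hn

/-! ### Gelfand-Tsetlin patterns -/

/-- Gelfand-Tsetlin patterns with top row `μ`: the row `x k` has at most `k` nonzero entries,
consecutive rows interlace, and the rows are constantly equal to `μ` from row `n` on. -/
structure IsGelfandTsetlin (n : ℕ) (μ : ℕ → ℕ) (x : ℕ → ℕ → ℕ) : Prop where
  le_succ : ∀ k i, x k i ≤ x (k + 1) i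
  succ_succ_le : ∀ k i, x (k + 1) (i + 1) ≤ x k i
  eq_zero : ∀ k i, k ≤ i → x k i = 0
  eq_top : ∀ k, n ≤ k → x k = μ

lemma IsGelfandTsetlin.le_top {n : ℕ} {μ : ℕ → ℕ} {x : ℕ → ℕ → ℕ} (hx : IsGelfandTsetlin n μ x)
    (k i : ℕ) : x k i ≤ μ i := by
  rw [← hx.eq_top (max n k) (le_max_left _ _)]
  exact monotone_nat_of_le_succ (f := fun k => x k i) (fun k => hx.le_succ k i) (le_max_right _ _)

lemma finite_isGelfandTsetlin (n : ℕ) (μ : ℕ → ℕ) : {x | IsGelfandTsetlin n μ x}.Finite := by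
  have hfin : (Set.univ.pi fun _ : Fin n => Set.univ.pi fun i : Fin n =>
      Set.Iic (μ i)).Finite :=
    Set.Finite.pi fun _ => Set.Finite.pi fun i => Set.finite_Iic _
  refine Set.Finite.of_injOn (f := fun (x : ℕ → ℕ → ℕ) (k i : Fin n) => x k i) ?_ ?_ hfin
  · intro x hx
    simp only [Set.mem_pi, Set.mem_univ, Set.mem_Iic, true_implies]
    exact fun k i => hx.le_top k i
  · intro x hx y hy hxy
    ext k i
    by_cases hk : n ≤ k
    · rw [hx.eq_top k hk, hy.eq_top k hk]
    by_cases hi : k ≤ i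
    · rw [hx.eq_zero k i hi, hy.eq_zero k i hi]
    exact congrFun (congrFun hxy ⟨k, by omega⟩) ⟨i, by omega⟩

/-- The finite set of Gelfand-Tsetlin patterns with top row `μ`. -/
def gelfandTsetlin (n : ℕ) (μ : ℕ → ℕ) : Finset (ℕ → ℕ → ℕ) :=
  (finite_isGelfandTsetlin n μ).toFinset

lemma mem_gelfandTsetlin {n : ℕ} {μ : ℕ → ℕ} {x : ℕ → ℕ → ℕ} :
    x ∈ gelfandTsetlin n μ ↔ IsGelfandTsetlin n μ x := by
  simp [gelfandTsetlin]

/-- The sum of the first `i` entries of the `k`-th row. -/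
def rowSum (x : ℕ → ℕ → ℕ) (k i : ℕ) : ℕ := ∑ j ∈ Finset.range i, x k j

lemma rowSum_zero (x : ℕ → ℕ → ℕ) (k : ℕ) : rowSum x k 0 = 0 := rfl

lemma rowSum_succ (x : ℕ → ℕ → ℕ) (k i : ℕ) : rowSum x k (i + 1) = rowSum x k i + x k i :=
  Finset.sum_range_succ _ _

lemma rowSum_congr {x y : ℕ → ℕ → ℕ} {k l i : ℕ} (h : ∀ j < i, x k j = y l j) :
    rowSum x k i = rowSum y l i :=
  Finset.sum_congr rfl fun j hj => h j (Finset.mem_range.1 hj)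

/-- The weight of a Gelfand-Tsetlin pattern. -/
def patternWeight (n : ℕ) (x : ℕ → ℕ → ℕ) (a : ℕ) : ℕ := rowSum x (a + 1) n - rowSum x a n

lemma IsGelfandTsetlin.patternWeight_add {n : ℕ} {μ : ℕ → ℕ} {x : ℕ → ℕ → ℕ}
    (hx : IsGelfandTsetlin n μ x) (a : ℕ) :
    patternWeight n x a + rowSum x a n = rowSum x (a + 1) n :=
  Nat.sub_add_cancel (Finset.sum_le_sum fun i _ => hx.le_succ a i)

/-- The Bender-Knuth toggle of the entries `i₀, i₀ + 1, …` of the row `a + 1`, where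
`c` is used as upper bound for the entry `i₀`. -/
def toggle (a i₀ c : ℕ) (x : ℕ → ℕ → ℕ) (k i : ℕ) : ℕ :=
  if k = a + 1 ∧ i₀ ≤ i then
    max (x (a + 2) (i + 1)) (x a i) +
      (if i = i₀ then c else min (x (a + 2) i) (x a (i - 1))) - x (a + 1) i
  else x k i

lemma toggle_of_ne {a i₀ c k : ℕ} (x : ℕ → ℕ → ℕ) (i : ℕ) (hk : k ≠ a + 1) :
    toggle a i₀ c x k i = x k i := if_neg fun h => hk h.1

lemma toggle_of_lt {a i₀ c i : ℕ} (x : ℕ → ℕ → ℕ) (k : ℕ) (hi : i < i₀) :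
    toggle a i₀ c x k i = x k i := if_neg fun h => (h.2.trans_lt hi).false

lemma toggle_self (a i₀ c : ℕ) (x : ℕ → ℕ → ℕ) :
    toggle a i₀ c x (a + 1) i₀ = max (x (a + 2) (i₀ + 1)) (x a i₀) + c - x (a + 1) i₀ := by
  simp [toggle]

lemma toggle_of_gt {a i₀ c i : ℕ} (x : ℕ → ℕ → ℕ) (hi : i₀ < i) :
    toggle a i₀ c x (a + 1) i = max (x (a + 2) (i + 1)) (x a i) +
      min (x (a + 2) i) (x a (i - 1)) - x (a + 1) i := by
  simp [toggle, hi.le, hi.ne']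

/-- `c` is an admissible upper bound for toggling the entries `i₀, i₀ + 1, …` of the row
`a + 1`. -/
structure IsToggleBound (a i₀ c : ℕ) (x : ℕ → ℕ → ℕ) : Prop where
  le : x (a + 1) i₀ ≤ c
  le_above : c ≤ x (a + 2) i₀
  le_below : ∀ j, i₀ = j + 1 → c ≤ x a j

section toggle

variable {n a i₀ c : ℕ} {μ : ℕ → ℕ} {x : ℕ → ℕ → ℕ}

lemma IsGelfandTsetlin.toggle_bounds (hx : IsGelfandTsetlin n μ x) (hc : IsToggleBound a i₀ c x)
    (i : ℕ) : x (a + 2) (i + 1) ≤ toggle a i₀ c x (a + 1) i ∧ x a i ≤ toggle a i₀ c x (a + 1) i ∧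
      toggle a i₀ c x (a + 1) i ≤ x (a + 2) i ∧
      ∀ j, i = j + 1 → toggle a i₀ c x (a + 1) i ≤ x a j := by
  have h1 := hx.le_succ a i
  have h2 : x (a + 2) (i + 1) ≤ x (a + 1) i := hx.succ_succ_le (a + 1) i
  have h3 : x (a + 1) i ≤ x (a + 2) i := hx.le_succ (a + 1) i
  have h4 (j) (hj : i = j + 1) : x (a + 1) i ≤ x a j := hj ▸ hx.succ_succ_le a j
  rcases lt_trichotomy i i₀ with h | rfl | h
  · rw [toggle_of_lt x _ h]
    exact ⟨h2, h1, h3, h4⟩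
  · rw [toggle_self]
    have := hc.le
    have := hc.le_above
    have := hc.le_below
    refine ⟨by omega, by omega, by omega, fun j hj => ?_⟩
    have := hc.le_below j hj
    omega
  · rw [toggle_of_gt x h]
    obtain ⟨j, rfl⟩ : ∃ j, i = j + 1 := ⟨i - 1, by omega⟩
    have := h4 j rfl
    rw [Nat.add_sub_cancel]
    refine ⟨by omega, by omega, by omega, fun j' hj => ?_⟩
    obtain rfl : j = j' := by omega
    omega

lemma IsGelfandTsetlin.toggle (hx : IsGelfandTsetlin n μ x) (hc : IsToggleBound a i₀ c x)
    (ha : a + 1 < n) : IsGelfandTsetlin n μ (toggle a i₀ c x) := by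
  have hb := hx.toggle_bounds hc
  refine ⟨fun k i => ?_, fun k i => ?_, fun k i hki => ?_, fun k hk => ?_⟩
  · by_cases h1 : k = a + 1
    · subst h1
      rw [toggle_of_ne (k := a + 1 + 1) x i (by omega)]
      exact (hb i).2.2.1
    by_cases h2 : k = a
    · subst h2
      rw [toggle_of_ne (k := k) x i (by omega)]
      exact (hb i).2.1
    rw [toggle_of_ne x i h1, toggle_of_ne x i (by omega)]
    exact hx.le_succ k i
  · by_cases h1 : k = a + 1
    · subst h1
      rw [toggle_of_ne (k := a + 1 + 1) x _ (by omega)]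
      exact (hb i).1
    by_cases h2 : k = a
    · subst h2
      rw [toggle_of_ne (k := k) x i (by omega)]
      exact (hb (i + 1)).2.2.2 i rfl
    rw [toggle_of_ne x i h1, toggle_of_ne x _ (by omega)]
    exact hx.succ_succ_le k i
  · by_cases h1 : k = a + 1
    · subst h1
      obtain ⟨j, rfl⟩ : ∃ j, i = j + 1 := ⟨i - 1, by omega⟩
      have := (hb (j + 1)).2.2.2 j rfl
      rw [hx.eq_zero a j (by omega)] at this
      omega
    · rw [toggle_of_ne x i h1, hx.eq_zero k i hki]
  · ext i
    rw [toggle_of_ne x i (by omega), hx.eq_top k hk]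

lemma IsToggleBound.toggle (hx : IsGelfandTsetlin n μ x) (hc : IsToggleBound a i₀ c x) :
    IsToggleBound a i₀ c (toggle a i₀ c x) := by
  have h1 := hx.le_succ a i₀
  have h2 : x (a + 2) (i₀ + 1) ≤ x (a + 1) i₀ := hx.succ_succ_le (a + 1) i₀
  refine ⟨?_, ?_, fun j hj => ?_⟩
  · rw [toggle_self]
    omega
  · rw [toggle_of_ne x _ (by omega)]
    exact hc.le_above
  · rw [toggle_of_ne x _ (by omega)]
    exact hc.le_below j hj

lemma IsGelfandTsetlin.toggle_toggle (hx : IsGelfandTsetlin n μ x) (hc : IsToggleBound a i₀ c x) :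
    _root_.toggle a i₀ c (_root_.toggle a i₀ c x) = x := by
  ext k i
  by_cases hk : k = a + 1
  swap
  · rw [toggle_of_ne _ i hk, toggle_of_ne x i hk]
  subst hk
  have h1 := hx.le_succ a i
  have h2 : x (a + 2) (i + 1) ≤ x (a + 1) i := hx.succ_succ_le (a + 1) i
  have h3 : x (a + 1) i ≤ x (a + 2) i := hx.le_succ (a + 1) i
  rcases lt_trichotomy i i₀ with h | rfl | h
  · rw [toggle_of_lt _ _ h, toggle_of_lt _ _ h]
  · rw [toggle_self, toggle_self, toggle_of_ne x _ (by omega), toggle_of_ne x _ (by omega)]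
    have := hc.le
    omega
  · rw [toggle_of_gt _ h, toggle_of_gt _ h, toggle_of_ne x _ (by omega),
      toggle_of_ne x _ (by omega), toggle_of_ne x _ (by omega), toggle_of_ne x _ (by omega)]
    obtain ⟨j, rfl⟩ : ∃ j, i = j + 1 := ⟨i - 1, by omega⟩
    have := hx.succ_succ_le a j
    rw [Nat.add_sub_cancel]
    omega

lemma IsGelfandTsetlin.rowSum_toggle_aux (hx : IsGelfandTsetlin n μ x)
    (hc : IsToggleBound a i₀ c x) {m : ℕ} (hm : i₀ ≤ m) :
    rowSum (_root_.toggle a i₀ c x) (a + 1) (m + 1) + rowSum x (a + 1) (m + 1) +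
        rowSum x (a + 2) i₀ + rowSum x a i₀ + x (a + 2) i₀ + x a m =
      2 * rowSum x (a + 1) i₀ + c + rowSum x (a + 2) (m + 1) + rowSum x a (m + 1) +
        max (x (a + 2) (m + 1)) (x a m) := by
  induction m, hm using Nat.le_induction with
  | base =>
    have h1 := hx.le_succ a i₀
    have h2 : x (a + 2) (i₀ + 1) ≤ x (a + 1) i₀ := hx.succ_succ_le (a + 1) i₀
    have h3 := hc.le
    have h4 : rowSum (_root_.toggle a i₀ c x) (a + 1) i₀ = rowSum x (a + 1) i₀ :=
      rowSum_congr fun j hj => toggle_of_lt x _ hj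
    simp only [rowSum_succ, h4, toggle_self]
    omega
  | succ m hm ih =>
    have h1 := hx.le_succ a (m + 1)
    have h2 : x (a + 2) (m + 1 + 1) ≤ x (a + 1) (m + 1) := hx.succ_succ_le (a + 1) (m + 1)
    have h3 : x (a + 1) (m + 1) ≤ x (a + 2) (m + 1) := hx.le_succ (a + 1) (m + 1)
    have h4 := hx.succ_succ_le a m
    rw [rowSum_succ _ _ (m + 1), rowSum_succ x _ (m + 1), rowSum_succ x _ (m + 1),
      rowSum_succ x _ (m + 1), toggle_of_gt x (by omega), Nat.add_sub_cancel]
    omega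

lemma IsGelfandTsetlin.rowSum_toggle (hx : IsGelfandTsetlin n μ x)
    (hc : IsToggleBound a i₀ c x) (ha : a + 1 < n) (hi : i₀ < n) :
    rowSum (_root_.toggle a i₀ c x) (a + 1) n + rowSum x (a + 1) n +
        rowSum x (a + 2) (i₀ + 1) + rowSum x a i₀ =
      2 * rowSum x (a + 1) i₀ + c + rowSum x (a + 2) n + rowSum x a n := by
  obtain ⟨m, rfl⟩ : ∃ m, n = m + 1 := ⟨n - 1, by omega⟩
  have h := hx.rowSum_toggle_aux hc (m := m) (by omega)
  rw [hx.eq_zero (a + 2) (m + 1) (by omega), hx.eq_zero a m (by omega)] at h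
  have := rowSum_succ x (a + 2) i₀
  omega

lemma patternWeight_toggle_of_ne {b : ℕ} (h1 : b ≠ a) (h2 : b ≠ a + 1) :
    patternWeight n (toggle a i₀ c x) b = patternWeight n x b := by
  rw [patternWeight, patternWeight,
    rowSum_congr (y := x) (l := b + 1) fun j _ => toggle_of_ne x j (by omega),
    rowSum_congr (y := x) (l := b) fun j _ => toggle_of_ne x j (by omega)]

lemma IsGelfandTsetlin.patternWeight_toggle (hx : IsGelfandTsetlin n μ x)
    (hc : IsToggleBound a i₀ c x) (ha : a + 1 < n) (hi : i₀ < n) :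
    patternWeight n (_root_.toggle a i₀ c x) a + rowSum x (a + 2) (i₀ + 1) + rowSum x a i₀ =
        2 * rowSum x (a + 1) i₀ + c + patternWeight n x (a + 1) ∧
      patternWeight n x a + rowSum x (a + 2) (i₀ + 1) + rowSum x a i₀ =
        2 * rowSum x (a + 1) i₀ + c + patternWeight n (_root_.toggle a i₀ c x) (a + 1) := by
  have h := hx.rowSum_toggle hc ha hi
  have h1 := hx.patternWeight_add a
  have h2 : _ = rowSum x (a + 2) n := hx.patternWeight_add (a + 1)
  have h3 := (hx.toggle hc ha).patternWeight_add a
  have h4 := (hx.toggle hc ha).patternWeight_add (a + 1)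
  rw [rowSum_congr (y := x) (k := a) (l := a) fun j _ => toggle_of_ne x j (by omega)] at h3
  rw [rowSum_congr (y := x) (k := a + 1 + 1) (l := a + 2)
    fun j _ => toggle_of_ne x j (by omega)] at h4
  omega

end toggle

/-! ### The pattern generating function -/

/-- The generating function of Gelfand-Tsetlin patterns with top row `μ`. -/
def patternSum (n : ℕ) (μ : ℕ → ℕ) : MvPolynomial (Fin n) ℚ :=
  ∑ x ∈ gelfandTsetlin n μ, ∏ a : Fin n, X a ^ patternWeight n x a

lemma IsGelfandTsetlin.isToggleBound {n : ℕ} {μ : ℕ → ℕ} {x : ℕ → ℕ → ℕ}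
    (hx : IsGelfandTsetlin n μ x) (a : ℕ) : IsToggleBound a 0 (x (a + 2) 0) x :=
  ⟨hx.le_succ _ _, le_rfl, fun _ h => by simp at h⟩

lemma rename_swap_patternSum (n : ℕ) (μ : ℕ → ℕ) (i : Fin n) :
    rename (Equiv.swap i.castSucc i.succ) (patternSum (n + 1) μ) = patternSum (n + 1) μ := by
  rw [patternSum, map_sum]
  have hmem (x) (hx : x ∈ gelfandTsetlin (n + 1) μ) :
      toggle i 0 (x (i + 2) 0) x ∈ gelfandTsetlin (n + 1) μ := by
    rw [mem_gelfandTsetlin] at hx ⊢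
    exact hx.toggle (hx.isToggleBound i) (by omega)
  have hinv (x) (hx : x ∈ gelfandTsetlin (n + 1) μ) :
      toggle i 0 (toggle i 0 (x (i + 2) 0) x (i + 2) 0) (toggle i 0 (x (i + 2) 0) x) = x := by
    rw [mem_gelfandTsetlin] at hx
    rw [toggle_of_ne x _ (by omega)]
    exact hx.toggle_toggle (hx.isToggleBound i)
  refine Finset.sum_nbij' (fun x => toggle i 0 (x (i + 2) 0) x)
    (fun x => toggle i 0 (x (i + 2) 0) x) hmem hmem hinv hinv fun x hx => ?_
  rw [mem_gelfandTsetlin] at hx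
  obtain ⟨h1, h2⟩ := hx.patternWeight_toggle (hx.isToggleBound i) (by omega) (Nat.succ_pos n)
  simp only [rowSum_succ, rowSum_zero] at h1 h2
  rw [map_prod, ← Equiv.prod_comp (Equiv.swap i.castSucc i.succ)]
  refine Finset.prod_congr rfl fun a _ => ?_
  rw [map_pow, rename_X, Equiv.swap_apply_self]
  congr 1
  by_cases ha1 : a = i.castSucc
  · subst ha1
    rw [Equiv.swap_apply_left, Fin.val_succ, Fin.val_castSucc]
    omega
  by_cases ha2 : a = i.succ
  · subst ha2
    rw [Equiv.swap_apply_right, Fin.val_succ, Fin.val_castSucc]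
    omega
  rw [Equiv.swap_apply_of_ne_of_ne ha1 ha2, patternWeight_toggle_of_ne]
  · simpa [Fin.ext_iff] using ha1
  · simpa [Fin.ext_iff] using ha2

lemma patternSum_isSymmetric (n : ℕ) (μ : ℕ → ℕ) : (patternSum n μ).IsSymmetric := by
  intro σ
  cases n with
  | zero => rw [Subsingleton.elim σ 1, Equiv.Perm.coe_one, rename_id_apply]
  | succ n =>
    have hσ : σ ∈ Submonoid.closure (Set.range fun i : Fin n => Equiv.swap i.castSucc i.succ) := by
      rw [Equiv.Perm.mclosure_swap_castSucc_succ]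
      trivial
    induction hσ using Submonoid.closure_induction with
    | mem σ h =>
      obtain ⟨i, rfl⟩ := h
      exact rename_swap_patternSum n μ i
    | one => rw [Equiv.Perm.coe_one, rename_id_apply]
    | mul σ τ _ _ hσ hτ => rw [Equiv.Perm.coe_mul, ← rename_rename, hτ, hσ]

/-! ### Cancellation of non-dominant patterns -/

/-- Dominance of a pattern relative to `lam` at the entries equal to `b + 1` in the `i`-th row of
the corresponding tableau: reading rows from top to bottom, and from right to left in every row,
the partial weights added to `lam` satisfy the inequality between the parts `b` and `b + 1`. -/
def IsDominantAt (lam : ℕ → ℕ) (x : ℕ → ℕ → ℕ) (i b : ℕ) : Prop :=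
  lam (b + 1) + rowSum x (b + 2) (i + 1) + rowSum x b i ≤
    lam b + rowSum x (b + 1) i + rowSum x (b + 1) (i + 1)

/-- A pattern is dominant relative to `lam` if it is so at all positions. -/
def IsDominant (n : ℕ) (lam : ℕ → ℕ) (x : ℕ → ℕ → ℕ) : Prop :=
  ∀ i b, b + 1 < n → IsDominantAt lam x i b

/-- The first position, in the reading order, at which dominance fails. -/
structure IsFirstFailure (n : ℕ) (lam : ℕ → ℕ) (x : ℕ → ℕ → ℕ) (i b : ℕ) : Prop where
  lt : b + 1 < n
  not_isDominantAt : ¬ IsDominantAt lam x i b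
  isDominantAt_of_lt : ∀ i' b', i' < i → b' + 1 < n → IsDominantAt lam x i' b'
  isDominantAt_of_gt : ∀ b', b < b' → b' + 1 < n → IsDominantAt lam x i b'

lemma IsFirstFailure.unique {n : ℕ} {lam : ℕ → ℕ} {x : ℕ → ℕ → ℕ} {i b i' b' : ℕ}
    (h : IsFirstFailure n lam x i b) (h' : IsFirstFailure n lam x i' b') : i = i' ∧ b = b' := by
  have hi : i = i' := by
    rcases lt_trichotomy i i' with hlt | heq | hlt
    · exact (h.not_isDominantAt (h'.isDominantAt_of_lt i b hlt h.lt)).elim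
    · exact heq
    · exact (h'.not_isDominantAt (h.isDominantAt_of_lt i' b' hlt h'.lt)).elim
  subst hi
  refine ⟨rfl, ?_⟩
  rcases lt_trichotomy b b' with hlt | heq | hlt
  · exact (h'.not_isDominantAt (h.isDominantAt_of_gt b' hlt h'.lt)).elim
  · exact heq
  · exact (h.not_isDominantAt (h'.isDominantAt_of_gt b hlt h.lt)).elim

lemma exists_isFirstFailure {n : ℕ} {lam : ℕ → ℕ} {x : ℕ → ℕ → ℕ} (h : ¬ IsDominant n lam x) :
    ∃ p : ℕ × ℕ, IsFirstFailure n lam x p.1 p.2 := by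
  classical
  have hex : ∃ i, ∃ b, b + 1 < n ∧ ¬ IsDominantAt lam x i b := by
    simpa [IsDominant] using h
  set i := Nat.find hex with hi
  obtain ⟨b₀, hb₀⟩ := Nat.find_spec hex
  set P : ℕ → Prop := fun b => b + 1 < n ∧ ¬ IsDominantAt lam x i b with hP
  have hb : P (Nat.findGreatest P n) := Nat.findGreatest_spec (m := b₀) (by omega) hb₀
  refine ⟨(i, Nat.findGreatest P n), hb.1, hb.2, fun i' b' hlt hb' => ?_, fun b' hlt hb' => ?_⟩
  · by_contra hbad
    exact Nat.find_min hex hlt ⟨b', hb', hbad⟩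
  · by_contra hbad
    exact Nat.findGreatest_is_greatest hlt (by omega) ⟨hb', hbad⟩

/-- The bound with which to toggle a pattern at its first failure of dominance. -/
def failureBound (lam : ℕ → ℕ) (x : ℕ → ℕ → ℕ) (i b : ℕ) : ℕ :=
  lam (b + 1) + rowSum x b i + rowSum x (b + 2) (i + 1) -
    (1 + lam b + 2 * rowSum x (b + 1) i)

section failure

variable {n : ℕ} {lam μ : ℕ → ℕ} {x : ℕ → ℕ → ℕ} {i b : ℕ}

lemma failureBound_add (h : ¬ IsDominantAt lam x i b) :
    failureBound lam x i b + (1 + lam b + 2 * rowSum x (b + 1) i) =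
      lam (b + 1) + rowSum x b i + rowSum x (b + 2) (i + 1) := by
  rw [IsDominantAt, rowSum_succ x (b + 1)] at h
  rw [failureBound]
  omega

lemma IsFirstFailure.isToggleBound (h : IsFirstFailure n lam x i b)
    (hx : IsGelfandTsetlin n μ x) (hlam : Antitone lam) :
    IsToggleBound b i (failureBound lam x i b) x := by
  have key := failureBound_add h.not_isDominantAt
  have hbad := h.not_isDominantAt
  rw [IsDominantAt, rowSum_succ x (b + 1)] at hbad
  have hl : lam (b + 1) ≤ lam b := hlam (Nat.le_succ b)
  cases i with
  | zero =>
    simp only [rowSum_zero, rowSum_succ] at *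
    exact ⟨by omega, by omega, fun j hj => by omega⟩
  | succ j =>
    have hok := h.isDominantAt_of_lt j b (Nat.lt_succ_self j) h.lt
    have h1 := hx.le_succ b j
    have h2 : x (b + 2) (j + 1) ≤ x (b + 1) j := hx.succ_succ_le (b + 1) j
    simp only [IsDominantAt, rowSum_succ] at hok hbad key
    refine ⟨by omega, by omega, fun j' hj => ?_⟩
    obtain rfl : j = j' := by omega
    omega

lemma rowSum_toggle_of_ne {k m c : ℕ} (hk : k ≠ b + 1) :
    rowSum (toggle b i c x) k m = rowSum x k m :=
  rowSum_congr fun j _ => toggle_of_ne x j hk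

lemma rowSum_toggle_of_le {k m c : ℕ} (hm : m ≤ i) :
    rowSum (toggle b i c x) k m = rowSum x k m :=
  rowSum_congr fun _ hj => toggle_of_lt x k (hj.trans_le hm)

lemma failureBound_toggle (c : ℕ) :
    failureBound lam (toggle b i c x) i b = failureBound lam x i b := by
  rw [failureBound, failureBound, rowSum_toggle_of_le le_rfl, rowSum_toggle_of_le le_rfl,
    rowSum_toggle_of_ne (by omega)]

lemma IsFirstFailure.toggle (h : IsFirstFailure n lam x i b)
    (hx : IsGelfandTsetlin n μ x) (hlam : Antitone lam) :
    IsFirstFailure n lam (_root_.toggle b i (failureBound lam x i b) x) i b := by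
  have hc := h.isToggleBound hx hlam
  refine ⟨h.lt, ?_, fun i' b' hi hb => ?_, fun b' hbb hb => ?_⟩
  · have key := failureBound_add h.not_isDominantAt
    have hle := (hc.toggle hx).le
    rw [IsDominantAt, rowSum_succ _ (b + 1), rowSum_toggle_of_le le_rfl,
      rowSum_toggle_of_le le_rfl, rowSum_toggle_of_ne (by omega)]
    omega
  · rw [IsDominantAt, rowSum_toggle_of_le (by omega), rowSum_toggle_of_le (by omega),
      rowSum_toggle_of_le (by omega), rowSum_toggle_of_le (by omega)]
    exact h.isDominantAt_of_lt i' b' hi hb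
  · rw [IsDominantAt, rowSum_toggle_of_ne (by omega), rowSum_toggle_of_le le_rfl,
      rowSum_toggle_of_le le_rfl, rowSum_toggle_of_ne (by omega)]
    exact h.isDominantAt_of_gt b' hbb hb

lemma IsFirstFailure.alternant_toggle (h : IsFirstFailure n lam x i b)
    (hx : IsGelfandTsetlin n μ x) (hlam : Antitone lam) :
    alternant n (addRho n (lam + patternWeight n (_root_.toggle b i (failureBound lam x i b) x))) =
      - alternant n (addRho n (lam + patternWeight n x)) := by
  have hc := h.isToggleBound hx hlam
  have key := failureBound_add h.not_isDominantAt
  have hb := h.lt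
  have hin : i < n := by
    by_contra! hle
    obtain ⟨j, rfl⟩ : ∃ j, i = j + 1 := ⟨i - 1, by omega⟩
    have hok := h.isDominantAt_of_lt j b (Nat.lt_succ_self j) hb
    have hbad := h.not_isDominantAt
    have hle' := hx.le_succ b j
    have hzero := hx.eq_zero (b + 2) (j + 1) (by omega)
    simp only [IsDominantAt, rowSum_succ] at hok hbad
    omega
  obtain ⟨h1, h2⟩ := hx.patternWeight_toggle hc hb hin
  set u : Fin n := ⟨b, by omega⟩
  set v : Fin n := ⟨b + 1, hb⟩
  have huv : u ≠ v := by simp [u, v]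
  have hcomp : addRho n (lam + patternWeight n (_root_.toggle b i (failureBound lam x i b) x)) =
      addRho n (lam + patternWeight n x) ∘ Equiv.swap u v := by
    ext a
    rw [Function.comp_apply]
    by_cases hau : a = u
    · subst hau
      rw [Equiv.swap_apply_left]
      simp only [addRho, Pi.add_apply, u, v]
      omega
    by_cases hav : a = v
    · subst hav
      rw [Equiv.swap_apply_right]
      simp only [addRho, Pi.add_apply, u, v]
      omega
    rw [Equiv.swap_apply_of_ne_of_ne hau hav]
    simp only [addRho, Pi.add_apply]
    rw [patternWeight_toggle_of_ne]
    · simpa [Fin.ext_iff, u] using hau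
    · simpa [Fin.ext_iff, v] using hav
  rw [hcomp, alternant_comp, Equiv.Perm.sign_swap huv]
  simp

end failure

/-- The sign-reversing involution on the patterns which are not dominant. -/
def cancelPattern (n : ℕ) (lam : ℕ → ℕ) (x : ℕ → ℕ → ℕ) : ℕ → ℕ → ℕ :=
  open Classical in
  if h : ∃ p : ℕ × ℕ, IsFirstFailure n lam x p.1 p.2 then
    toggle h.choose.2 h.choose.1 (failureBound lam x h.choose.1 h.choose.2) x
  else x

lemma IsFirstFailure.cancelPattern_eq {n : ℕ} {lam : ℕ → ℕ} {x : ℕ → ℕ → ℕ} {i b : ℕ}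
    (h : IsFirstFailure n lam x i b) :
    cancelPattern n lam x = _root_.toggle b i (failureBound lam x i b) x := by
  have hex : ∃ p : ℕ × ℕ, IsFirstFailure n lam x p.1 p.2 := ⟨(i, b), h⟩
  obtain ⟨h1, h2⟩ := hex.choose_spec.unique h
  rw [cancelPattern, dif_pos hex, h1, h2]

open Classical in
lemma sum_alternant_not_isDominant (n : ℕ) (lam μ : ℕ → ℕ) (hlam : Antitone lam) :
    ∑ x ∈ gelfandTsetlin n μ with ¬ IsDominant n lam x,
      alternant n (addRho n (lam + patternWeight n x)) = 0 := by
  refine Finset.sum_involution (fun x _ => cancelPattern n lam x) ?_ ?_ ?_ ?_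
  · intro x hx
    rw [Finset.mem_filter, mem_gelfandTsetlin] at hx
    obtain ⟨p, hp⟩ := exists_isFirstFailure hx.2
    rw [hp.cancelPattern_eq, hp.alternant_toggle hx.1 hlam, add_neg_cancel]
  · intro x hx hne heq
    rw [Finset.mem_filter, mem_gelfandTsetlin] at hx
    obtain ⟨p, hp⟩ := exists_isFirstFailure hx.2
    have h := hp.alternant_toggle hx.1 hlam
    rw [← hp.cancelPattern_eq, heq] at h
    exact hne (self_eq_neg.1 h)
  · intro x hx
    rw [Finset.mem_filter, mem_gelfandTsetlin] at hx ⊢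
    obtain ⟨p, hp⟩ := exists_isFirstFailure hx.2
    rw [hp.cancelPattern_eq]
    exact ⟨hx.1.toggle (hp.isToggleBound hx.1 hlam) hp.lt,
      fun hd => (hp.toggle hx.1 hlam).not_isDominantAt (hd _ _ hp.lt)⟩
  · intro x hx
    rw [Finset.mem_filter, mem_gelfandTsetlin] at hx
    obtain ⟨p, hp⟩ := exists_isFirstFailure hx.2
    rw [(hp.cancelPattern_eq ▸ hp.toggle hx.1 hlam :
      IsFirstFailure n lam (cancelPattern n lam x) p.1 p.2).cancelPattern_eq, hp.cancelPattern_eq,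
      failureBound_toggle, hx.1.toggle_toggle (hp.isToggleBound hx.1 hlam)]

open Classical in
lemma alternant_mul_patternSum (n : ℕ) (lam μ : ℕ → ℕ) (hlam : Antitone lam) :
    alternant n (addRho n lam) * patternSum n μ =
      ∑ x ∈ gelfandTsetlin n μ with IsDominant n lam x,
        alternant n (addRho n (lam + patternWeight n x)) := by
  have h := Finset.sum_filter_add_sum_filter_not (gelfandTsetlin n μ) (IsDominant n lam)
    fun x => alternant n (addRho n (lam + patternWeight n x))
  rw [sum_alternant_not_isDominant n lam μ hlam, add_zero] at h
  rw [h, ← antisymmetrize_prod_X_pow, ← antisymmetrize_mul n _ _ (patternSum_isSymmetric n μ),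
    patternSum, Finset.mul_sum, map_sum]
  refine Finset.sum_congr rfl fun x _ => ?_
  rw [← Finset.prod_mul_distrib, ← antisymmetrize_prod_X_pow]
  congr 1
  refine Finset.prod_congr rfl fun a _ => ?_
  rw [← pow_add]
  congr 1
  simp only [addRho, Pi.add_apply]
  omega

/-- The first `n` parts of `lam + patternWeight n x`. -/
def addWeight (n : ℕ) (lam : ℕ → ℕ) (x : ℕ → ℕ → ℕ) (a : ℕ) : ℕ :=
  if a < n then lam a + patternWeight n x a else 0

lemma addWeight_apply_self (n : ℕ) (lam : ℕ → ℕ) (x : ℕ → ℕ → ℕ) : addWeight n lam x n = 0 :=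
  if_neg (lt_irrefl n)

lemma addRho_addWeight (n : ℕ) (lam : ℕ → ℕ) (x : ℕ → ℕ → ℕ) :
    addRho n (addWeight n lam x) = addRho n (lam + patternWeight n x) := by
  ext a
  simp [addRho, addWeight, a.2]

lemma IsDominant.isPartition {n : ℕ} {lam μ : ℕ → ℕ} {x : ℕ → ℕ → ℕ}
    (h : IsDominant n lam x) (hx : IsGelfandTsetlin n μ x) : IsPartition (addWeight n lam x) := by
  refine ⟨antitone_nat_of_succ_le fun b => ?_, n, fun i hi => if_neg (by omega)⟩
  by_cases hb : b + 1 < n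
  · have hd := h n b hb
    have h1 := hx.patternWeight_add b
    have h2 : _ = rowSum x (b + 2) n := hx.patternWeight_add (b + 1)
    rw [IsDominantAt, rowSum_succ, rowSum_succ, hx.eq_zero (b + 2) n (by omega),
      hx.eq_zero (b + 1) n (by omega)] at hd
    rw [addWeight, addWeight, if_pos hb, if_pos (by omega)]
    omega
  · rw [addWeight, if_neg hb]
    exact Nat.zero_le _

/-- The unique dominant pattern relative to the empty partition. -/
def highestPattern (μ : ℕ → ℕ) (k i : ℕ) : ℕ := if i < k then μ i else 0

lemma isGelfandTsetlin_highestPattern {n : ℕ} {μ : ℕ → ℕ} (hμ : IsPartition μ) (hn : μ n = 0) :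
    IsGelfandTsetlin n μ (highestPattern μ) := by
  refine ⟨fun k i => ?_, fun k i => ?_, fun k i hki => if_neg (by omega), fun k hk => ?_⟩
  · simp only [highestPattern]
    split_ifs <;> omega
  · have := hμ.1 (Nat.le_succ i)
    simp only [highestPattern]
    split_ifs <;> omega
  · ext i
    simp only [highestPattern]
    split_ifs with h
    · rfl
    · rw [hμ.eq_zero_of_le hn (by omega)]

lemma rowSum_highestPattern_succ (μ : ℕ → ℕ) (k i : ℕ) :
    rowSum (highestPattern μ) (k + 1) i =
      rowSum (highestPattern μ) k i + if k < i then μ k else 0 := by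
  induction i with
  | zero => simp [rowSum_zero]
  | succ i ih =>
    rw [rowSum_succ, rowSum_succ, ih, highestPattern, highestPattern]
    rcases lt_trichotomy k i with h | rfl | h
    · simp [h, h.trans (Nat.lt_succ_self i), show ¬ i < k + 1 by omega, show ¬ i < k by omega]
    · simp
    · simp [show ¬ k < i by omega, show ¬ k < i + 1 by omega, show i < k + 1 by omega, h]

lemma isDominant_highestPattern (n : ℕ) {μ : ℕ → ℕ} (hμ : IsPartition μ) :
    IsDominant n 0 (highestPattern μ) := by
  intro i b _
  have : μ (b + 1) ≤ μ b := hμ.1 (Nat.le_succ b)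
  simp only [IsDominantAt, Pi.zero_apply, rowSum_highestPattern_succ]
  split_ifs <;> omega

lemma IsGelfandTsetlin.eq_highestPattern {n : ℕ} {μ : ℕ → ℕ} {x : ℕ → ℕ → ℕ}
    (hx : IsGelfandTsetlin n μ x) (h : IsDominant n 0 x) : x = highestPattern μ := by
  have hstep (i : ℕ) : ∀ b, i < b → b < n → x (b + 1) i = x b i := by
    induction i using Nat.strong_induction_on with
    | _ i ih =>
      intro b hib hb
      obtain ⟨b, rfl⟩ : ∃ a, b = a + 1 := ⟨b - 1, by omega⟩
      have hd := h i b hb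
      have h1 : rowSum x (b + 2) i = rowSum x (b + 1) i :=
        rowSum_congr fun j hj => ih j hj (b + 1) (by omega) hb
      have h2 : rowSum x (b + 1) i = rowSum x b i :=
        rowSum_congr fun j hj => ih j hj b (by omega) (by omega)
      have h3 : x (b + 1) i ≤ x (b + 2) i := hx.le_succ (b + 1) i
      simp only [IsDominantAt, rowSum_succ, Pi.zero_apply] at hd
      change x (b + 2) i = _
      omega
  ext k i
  rw [highestPattern]
  split_ifs with hik
  · by_cases hk : n ≤ k
    · rw [hx.eq_top k hk]
    · push Not at hk
      have hle : ∀ m, k ≤ m → m ≤ n → x m i = x k i := by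
        intro m hkm
        induction m, hkm using Nat.le_induction with
        | base => exact fun _ => rfl
        | succ m hkm ih => exact fun hm => (hstep i m (by omega) (by omega)).trans (ih (by omega))
      rw [← congrFun (hx.eq_top n le_rfl) i]
      exact (hle n hk.le le_rfl).symm
  · exact hx.eq_zero k i (by omega)

/-! ### Products of Schur polynomials -/

lemma patternSum_eq_schur {n : ℕ} {μ : ℕ → ℕ} (hμ : IsPartition μ) (hn : μ n = 0) :
    patternSum n μ = schur n μ := by
  classical
  have hfilter : {x ∈ gelfandTsetlin n μ | IsDominant n 0 x} = {highestPattern μ} := by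
    ext x
    rw [Finset.mem_filter, mem_gelfandTsetlin, Finset.mem_singleton]
    constructor
    · exact fun h => h.1.eq_highestPattern h.2
    · rintro rfl
      exact ⟨isGelfandTsetlin_highestPattern hμ hn, isDominant_highestPattern n hμ⟩
  have hweight : addRho n (0 + patternWeight n (highestPattern μ)) = addRho n μ := by
    ext a
    simp [addRho, patternWeight, rowSum_highestPattern_succ]
  have h := alternant_mul_patternSum n 0 μ fun _ _ _ => le_rfl
  have hsum : ∑ x ∈ gelfandTsetlin n μ with IsDominant n 0 x,
      alternant n (addRho n (0 + patternWeight n x)) = alternant n (addRho n μ) := by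
    rw [hfilter, Finset.sum_singleton, hweight]
  refine mul_left_cancel₀ (alternant_addRho_zero_ne_zero n) ?_
  rw [mul_comm _ (schur n μ), schur_mul_alternant hμ hn, ← hsum]
  convert h

open Classical in
/-- The Littlewood-Richardson rule, in terms of Gelfand-Tsetlin patterns. -/
lemma schur_mul_schur {n : ℕ} {lam μ : ℕ → ℕ} (hlam : IsPartition lam) (hln : lam n = 0)
    (hμ : IsPartition μ) (hμn : μ n = 0) :
    schur n lam * schur n μ =
      ∑ x ∈ gelfandTsetlin n μ with IsDominant n lam x, schur n (addWeight n lam x) := by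
  refine mul_right_cancel₀ (alternant_addRho_zero_ne_zero n) ?_
  rw [mul_right_comm, schur_mul_alternant hlam hln, ← patternSum_eq_schur hμ hμn,
    alternant_mul_patternSum n lam μ hlam.1, Finset.sum_mul]
  refine Finset.sum_congr rfl fun x hx => ?_
  rw [Finset.mem_filter, mem_gelfandTsetlin] at hx
  rw [schur_mul_alternant (hx.2.isPartition hx.1) (addWeight_apply_self n lam x),
    addRho_addWeight]

lemma SchurPositive.mul {n : ℕ} {f g : MvPolynomial (Fin n) ℚ} (hf : SchurPositive n f)
    (hg : SchurPositive n g) : SchurPositive n (f * g) := by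
  classical
  refine hf.induction (P := fun f => SchurPositive n (f * g)) ?_ ?_ ?_ ?_
  · simpa using SchurPositive.zero n
  · intro f₁ f₂ h₁ h₂
    rw [add_mul]
    exact h₁.add h₂
  · intro c f₁ hc h
    rw [smul_mul_assoc]
    exact h.smul hc
  intro lam hlam hln
  refine hg.induction (P := fun g => SchurPositive n (schur n lam * g)) ?_ ?_ ?_ ?_
  · simpa using SchurPositive.zero n
  · intro f₁ f₂ h₁ h₂
    rw [mul_add]
    exact h₁.add h₂
  · intro c f₁ hc h
    rw [mul_smul_comm]
    exact h.smul hc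
  intro μ hμ hμn
  rw [schur_mul_schur hlam hln hμ hμn]
  refine SchurPositive.sum _ _ fun x hx => ?_
  rw [Finset.mem_filter, mem_gelfandTsetlin] at hx
  exact (hx.2.isPartition hx.1).schurPositive n

/-- if `p` and `q` are Schur positive homogeneous symmetric polynomials in
`n` variables such that `(p^(1))^2 - p * p^(2)` and `(q^(1))^2 - q * q^(2)` are Schur
positive, then `((pq)^(1))^2 - (pq) * (pq)^(2)` is Schur positive. -/
theorem product_schur_positive (n : ℕ) (p q : MvPolynomial (Fin n) ℚ)
    (hps : p.IsSymmetric) (hqs : q.IsSymmetric)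
    (hph : ∃ d, p.IsHomogeneous d) (hqh : ∃ d, q.IsHomogeneous d)
    (hpp : SchurPositive n p) (hqp : SchurPositive n q)
    (hpd : SchurPositive n ((derived n 1 p) ^ 2 - p * derived n 2 p))
    (hqd : SchurPositive n ((derived n 1 q) ^ 2 - q * derived n 2 q)) :
    SchurPositive n ((derived n 1 (p * q)) ^ 2 - p * q * derived n 2 (p * q)) := by
  have h : (derived n 1 (p * q)) ^ 2 - p * q * derived n 2 (p * q) =
      ((derived n 1 p) ^ 2 - p * derived n 2 p) * (q * q) +
        (p * derived n 1 p) * (q * derived n 1 q) +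
        (p * p) * ((derived n 1 q) ^ 2 - q * derived n 2 q) := by
    rw [derived_one_mul, derived_two_mul]
    ring
  rw [h]
  exact ((hpd.mul (hqp.mul hqp)).add
    ((hpp.mul hpp.derived_one).mul (hqp.mul hqp.derived_one))).add ((hpp.mul hpp).mul hqd)

end
end
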